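/- arXiv:0805.3913 — 18 statements merged into one kernel-verified Lean document; each statement's English description precedes it below -/
import Mathlib

section
/- Let (V, ω) be a finite-dimensional real symplectic vector space and let 𝔄 be a linear subspace of End(V) all of whose elements are ω-skew, and which is closed under composition (A, B ∈ 𝔄 implies A∘B ∈ 𝔄). Then for all A, B ∈ 𝔄 one has A∘B = −B∘A, and for all A, B, C ∈ 𝔄 one has A∘B∘C = 0. -/
/-- Let `(V, ω)` be a finite-dimensional real symplectic vector space and `𝔄`
a linear subspace of `End(V)` consisting of `ω`-skew endomorphisms and closed under
composition. Then `A∘B = −B∘A` for all `A, B ∈ 𝔄` and `A∘B∘C = 0` for all `A, B, C ∈ 𝔄`. -/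
theorem skew_subalgebra_anticommute_and_triple_zero
    (V : Type*) [AddCommGroup V] [Module ℝ V] [FiniteDimensional ℝ V]
    (ω : LinearMap.BilinForm ℝ V) (hAlt : ω.IsAlt) (hNd : ω.Nondegenerate)
    (𝔄 : Submodule ℝ (V →ₗ[ℝ] V))
    (hskew : ∀ A ∈ 𝔄, ∀ x y, ω (A x) y + ω x (A y) = 0)
    (hcomp : ∀ A ∈ 𝔄, ∀ B ∈ 𝔄, A ∘ₗ B ∈ 𝔄) :
    (∀ A ∈ 𝔄, ∀ B ∈ 𝔄, A ∘ₗ B = -(B ∘ₗ A)) ∧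
    (∀ A ∈ 𝔄, ∀ B ∈ 𝔄, ∀ C ∈ 𝔄, A ∘ₗ B ∘ₗ C = 0) := by
  have anticomm : ∀ A ∈ 𝔄, ∀ B ∈ 𝔄, A ∘ₗ B = -(B ∘ₗ A) := by
    intro A hA B hB
    ext y
    rw [LinearMap.neg_apply, ← add_eq_zero_iff_eq_neg]
    refine hNd.2 _ fun x => ?_
    have h₁ := hskew _ (hcomp A hA B hB) x y
    have h₂ := hskew A hA (B x) y
    have h₃ := hskew B hB x (A y)
    simp only [LinearMap.comp_apply, map_add] at h₁ ⊢
    linarith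
  refine ⟨anticomm, fun A hA B hB C hC => ?_⟩
  have h : A ∘ₗ B ∘ₗ C = -(A ∘ₗ B ∘ₗ C) :=
    calc A ∘ₗ B ∘ₗ C = -((C ∘ₗ A) ∘ₗ B) := anticomm _ (hcomp A hA B hB) C hC
      _ = A ∘ₗ C ∘ₗ B := by
        rw [anticomm C hC A hA, LinearMap.neg_comp, neg_neg, LinearMap.comp_assoc]
      _ = -(A ∘ₗ B ∘ₗ C) := by rw [anticomm C hC B hB, LinearMap.comp_neg]
  have : IsAddTorsionFree (V →ₗ[ℝ] V) := .of_isTorsionFree ℝ _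
  exact self_eq_neg.mp h
end

section
/- Let V and W be real vector spaces, let ν be an alternating bilinear form on W, and let α : V × V → W be a symmetric bilinear map. Define R(x,y,z,t) := ν(α(y,z), α(x,t)) − ν(α(x,z), α(y,t)). Then R(x,y,z,t) = 0 for all x, y, z, t ∈ V if and only if ν(α(x,y), α(z,w)) = 0 for all x, y, z, w ∈ V (i.e. the span of the image of α is ν-isotropic). -/
/-- Let `V, W` be real vector spaces, `ν` an alternating bilinear form on `W`,
and `α : V × V → W` a symmetric bilinear map. Define
`R(x,y,z,t) := ν(α(y,z), α(x,t)) − ν(α(x,z), α(y,t))`. Then `R ≡ 0` iff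
`ν(α(x,y), α(z,w)) = 0` for all `x, y, z, w` (the span of the image of `α` is `ν`-isotropic). -/
theorem curvature_zero_iff_image_isotropic
    (V W : Type*) [AddCommGroup V] [Module ℝ V] [AddCommGroup W] [Module ℝ W]
    (ν : LinearMap.BilinForm ℝ W) (hAlt : ν.IsAlt)
    (α : V →ₗ[ℝ] V →ₗ[ℝ] W) (hsym : ∀ x y, α x y = α y x) :
    (∀ x y z t : V, ν (α y z) (α x t) - ν (α x z) (α y t) = 0) ↔
      (∀ x y z w : V, ν (α x y) (α z w) = 0) := by
  refine ⟨fun hR x y z w => ?_, fun h x y z t => by simp [h]⟩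
  have swap (a b c d : V) : ν (α a b) (α c d) = ν (α c b) (α a d) :=
    sub_eq_zero.mp (hR c a b d)
  have h : ν (α x y) (α z w) = -ν (α x y) (α z w) := calc
    ν (α x y) (α z w) = ν (α z y) (α x w) := swap x y z w
    _ = ν (α y z) (α w x) := by rw [hsym z y, hsym x w]
    _ = ν (α w z) (α y x) := swap y z w x
    _ = ν (α z w) (α x y) := by rw [hsym w z, hsym y x]
    _ = -ν (α x y) (α z w) := (hAlt.neg_eq _ _).symm
  exact self_eq_neg.mp h
end

section
/- Let (V₁, ω₁) and (V₂, ω₂) be finite-dimensional real symplectic vector spaces. Let B : V₂ → End(V₂) and C : V₂ → End(V₁) be linear maps such that every B(ξ) is ω₂-skew, every C(ξ) is ω₁-skew, and for all ξ, η ∈ V₂: B(B(ξ)η) = B(ξ)∘B(η), C(B(ξ)η) = 0, and C(ξ)∘C(η) = 0. Define M := {(x,u) ∈ V₁ × V₂ : for all ξ ∈ V₂, (1/2)ω₁(x, C(ξ)x) + (1/2)ω₂(u, B(ξ)u) − ω₂(u, ξ) = 0} and N := {(x,u) ∈ V₁ × V₂ : for all ξ ∈ V₂, (1/2)ω₁(x,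 C(ξ)x) − ω₂(u, ξ) = 0}. Then M = N. -/
/-- With linear maps `B : V₂ → End(V₂)` and `C : V₂ → End(V₁)` consisting of
skew endomorphisms, with `B(B(ξ)η) = B(ξ)∘B(η)`, `C(B(ξ)η) = 0` and `C(ξ)∘C(η) = 0`,
the sets `M` and `N` defined by the quadratic equations coincide. -/
theorem extrinsic_graph_sets_eq
    (V₁ V₂ : Type*) [AddCommGroup V₁] [Module ℝ V₁] [FiniteDimensional ℝ V₁]
    [AddCommGroup V₂] [Module ℝ V₂] [FiniteDimensional ℝ V₂]
    (ω₁ : LinearMap.BilinForm ℝ V₁) (h₁Alt : ω₁.IsAlt) (h₁Nd : ω₁.Nondegenerate)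
    (ω₂ : LinearMap.BilinForm ℝ V₂) (h₂Alt : ω₂.IsAlt) (h₂Nd : ω₂.Nondegenerate)
    (B : V₂ →ₗ[ℝ] V₂ →ₗ[ℝ] V₂) (C : V₂ →ₗ[ℝ] V₁ →ₗ[ℝ] V₁)
    (hBskew : ∀ ξ x y, ω₂ (B ξ x) y + ω₂ x (B ξ y) = 0)
    (hCskew : ∀ ξ x y, ω₁ (C ξ x) y + ω₁ x (C ξ y) = 0)
    (hBB : ∀ ξ η, B (B ξ η) = B ξ ∘ₗ B η)
    (hCB : ∀ ξ η, C (B ξ η) = 0)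
    (hCC : ∀ ξ η, C ξ ∘ₗ C η = 0) :
    {p : V₁ × V₂ | ∀ ξ : V₂,
        (1/2 : ℝ) * ω₁ p.1 (C ξ p.1) + (1/2 : ℝ) * ω₂ p.2 (B ξ p.2) - ω₂ p.2 ξ = 0} =
      {p : V₁ × V₂ | ∀ ξ : V₂, (1/2 : ℝ) * ω₁ p.1 (C ξ p.1) - ω₂ p.2 ξ = 0} := by
  have hsq : ∀ u x y, ω₂ x (B u (B u y)) = 0 := by
    intro u x y
    have h1 := hBskew (B u u) x y
    have h2 := hBskew u (B u x) y
    have h3 := hBskew u x (B u y)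
    simp only [hBB, LinearMap.comp_apply] at h1
    linarith
  ext ⟨x, u⟩
  simp only [Set.mem_ofPred_eq]
  constructor
  · intro h ξ
    have h1 := h (B ξ u)
    have h2 := h (B ξ (B u u))
    have h3 := hBskew ξ u (B u (B u u))
    have h4 := hsq u (B ξ u) u
    simp only [hCB, hBB, LinearMap.comp_apply, LinearMap.zero_apply, map_zero] at h1 h2
    linarith [h ξ]
  · intro h ξ
    have h1 := h (B ξ u)
    simp only [hCB, LinearMap.zero_apply, map_zero] at h1
    linarith [h ξ]
end

section
/- Let (V₁, ω₁) and (V₂, ω₂) be finite-dimensional real symplectic vector spaces. Let B : V₂ → End(V₂) and C : V₂ → End(V₁) be linear maps such that every B(ξ) is ω₂-skew, every C(ξ) is ω₁-skew, and for all ξ, η ∈ V₂: B(B(ξ)η) = B(ξ)∘B(η), C(B(ξ)η) = 0, and C(ξ)∘C(η) = 0. If (x,u) ∈ V₁ × V₂ satisfies (1/2)ω₁(x, C(ξ)x) + (1/2)ω₂(u, B(ξ)u) − ω₂(u, ξ) = 0 for all ξ ∈ V₂, then B(ξ)u = 0 for all ξ ∈ V₂. -/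
/-- With the data of Statement 3, if `(x,u)` satisfies
`(1/2)ω₁(x, C(ξ)x) + (1/2)ω₂(u, B(ξ)u) − ω₂(u, ξ) = 0` for all `ξ`, then `B(ξ)u = 0`
for all `ξ`. -/
theorem extrinsic_graph_B_annihilates
    (V₁ V₂ : Type*) [AddCommGroup V₁] [Module ℝ V₁] [FiniteDimensional ℝ V₁]
    [AddCommGroup V₂] [Module ℝ V₂] [FiniteDimensional ℝ V₂]
    (ω₁ : LinearMap.BilinForm ℝ V₁) (h₁Alt : ω₁.IsAlt) (h₁Nd : ω₁.Nondegenerate)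
    (ω₂ : LinearMap.BilinForm ℝ V₂) (h₂Alt : ω₂.IsAlt) (h₂Nd : ω₂.Nondegenerate)
    (B : V₂ →ₗ[ℝ] V₂ →ₗ[ℝ] V₂) (C : V₂ →ₗ[ℝ] V₁ →ₗ[ℝ] V₁)
    (hBskew : ∀ ξ x y, ω₂ (B ξ x) y + ω₂ x (B ξ y) = 0)
    (hCskew : ∀ ξ x y, ω₁ (C ξ x) y + ω₁ x (C ξ y) = 0)
    (hBB : ∀ ξ η, B (B ξ η) = B ξ ∘ₗ B η)
    (hCB : ∀ ξ η, C (B ξ η) = 0)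
    (hCC : ∀ ξ η, C ξ ∘ₗ C η = 0)
    (x : V₁) (u : V₂)
    (hxu : ∀ ξ : V₂,
      (1/2 : ℝ) * ω₁ x (C ξ x) + (1/2 : ℝ) * ω₂ u (B ξ u) - ω₂ u ξ = 0) :
    ∀ ξ : V₂, B ξ u = 0 := by
  have sepLeft : ∀ a, (∀ b, ω₂ a b = 0) → a = 0 := h₂Nd.1
  have antisymm : ∀ a b, ω₂ a b = -ω₂ b a := fun a b => (h₂Alt.neg_eq b a).symm
  have B_comp : ∀ ξ η a, B (B ξ η) a = B ξ (B η a) := fun ξ η a => by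
    rw [hBB]; rfl
  have B_sq : ∀ ξ a, B ξ (B ξ a) = 0 := by
    intro ξ a
    refine sepLeft _ fun b => ?_
    have h := hBskew (B ξ ξ) a b
    rw [B_comp, B_comp] at h
    linarith [hBskew ξ (B ξ a) b, hBskew ξ a (B ξ b)]
  have half_eq : ∀ η ζ, (1/2 : ℝ) * ω₂ (B η u) (B ζ u) = ω₂ (B η u) ζ := by
    intro η ζ
    have h := hxu (B η ζ)
    rw [hCB, B_comp] at h
    simp only [LinearMap.zero_apply, map_zero, mul_zero, zero_add] at h
    linarith [hBskew η u (B ζ u), hBskew η u ζ]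
  -- Right multiplication `ζ ↦ B ζ u` is `ω₂`-self-adjoint, hence squares to twice itself.
  have selfAdjoint : ∀ η ζ, ω₂ (B η u) ζ = ω₂ η (B ζ u) := by
    intro η ζ
    linarith [half_eq η ζ, half_eq ζ η, antisymm (B η u) (B ζ u), antisymm (B ζ u) η]
  have sq_eq : ∀ ζ, B ζ (B u u) = (2 : ℝ) • B ζ u := by
    intro ζ
    rw [← sub_eq_zero, ← B_comp]
    refine sepLeft _ fun η => ?_
    rw [map_sub, map_smul, LinearMap.sub_apply, LinearMap.smul_apply, smul_eq_mul]
    linarith [selfAdjoint (B ζ u) η, half_eq ζ η]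
  have B_u_u : B u u = 0 := by
    have h := sq_eq u
    rw [B_sq] at h
    exact (smul_eq_zero.mp h.symm).resolve_left two_ne_zero
  intro ξ
  have h := sq_eq ξ
  rw [B_u_u, map_zero] at h
  exact (smul_eq_zero.mp h.symm).resolve_left two_ne_zero
end

section
/- Let (V, Ω) be a finite-dimensional real symplectic vector space. Let A₁, …, A_m be linearly independent Ω-skew endomorphisms of V, let a₁, …, a_m ∈ V be vectors whose Gram matrix (Ω(aᵢ, aⱼ))ᵢⱼ is invertible, and suppose there are real constants B^k_{ij} such that Aᵢ∘Aⱼ = Σ_k B^k_{ij} A_k and Aᵢ aⱼ = Σ_k B^k_{ij} a_k for all i, j. Then Aᵢ∘Aⱼ = 0 for all i, j. -/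
/-- If `A₁, …, A_m` are linearly independent `Ω`-skew endomorphisms,
`a₁, …, a_m` vectors with invertible Gram matrix `(Ω(aᵢ,aⱼ))`, and
`Aᵢ∘Aⱼ = Σ_k B^k_{ij} A_k`, `Aᵢ aⱼ = Σ_k B^k_{ij} a_k`, then `Aᵢ∘Aⱼ = 0` for all `i, j`. -/
theorem linearIndependent_structure_implies_products_zero
    (V : Type*) [AddCommGroup V] [Module ℝ V] [FiniteDimensional ℝ V]
    (Ω : LinearMap.BilinForm ℝ V) (hAlt : Ω.IsAlt) (hNd : Ω.Nondegenerate)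
    (m : ℕ) (A : Fin m → (V →ₗ[ℝ] V)) (a : Fin m → V)
    (hskew : ∀ i, ∀ x y, Ω (A i x) y + Ω x (A i y) = 0)
    (hli : LinearIndependent ℝ A)
    (hGram : IsUnit (Matrix.of fun i j => Ω (a i) (a j) : Matrix (Fin m) (Fin m) ℝ))
    (B : Fin m → Fin m → Fin m → ℝ)
    (hAA : ∀ i j, A i ∘ₗ A j = ∑ k, B i j k • A k)
    (hAa : ∀ i j, A i (a j) = ∑ k, B i j k • a k) :
    ∀ i j, A i ∘ₗ A j = 0 := by
  have skew_comp : ∀ i j x y, Ω (A i (A j x)) y + Ω x (A i (A j y)) = 0 := by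
    intro i j x y
    have h : ∀ z, A i (A j z) = ∑ k, B i j k • A k z := fun z => by
      simpa using LinearMap.congr_fun (hAA i j) z
    simp only [h, map_sum, map_smul, LinearMap.sum_apply, LinearMap.smul_apply, smul_eq_mul]
    rw [← Finset.sum_add_distrib]
    exact Finset.sum_eq_zero fun k _ => by rw [← mul_add, hskew, mul_zero]
  have anticomm : ∀ i j, A i ∘ₗ A j + A j ∘ₗ A i = 0 := by
    intro i j
    ext y
    refine hNd.2 _ fun x => ?_
    have h₁ := skew_comp i j x y
    have h₂ := hskew i (A j x) y
    have h₃ := hskew j x (A i y)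
    simp only [LinearMap.add_apply, LinearMap.comp_apply, map_add]
    linarith
  have B_antisymm : ∀ i j k, B i j k + B j i k = 0 := by
    intro i j
    refine Fintype.linearIndependent_iff.mp hli (fun k => B i j k + B j i k) ?_
    simp only [add_smul, Finset.sum_add_distrib]
    rw [← hAA, ← hAA, anticomm]
  have swap_left : ∀ i j k, Ω (A i (a j)) (a k) + Ω (A j (a i)) (a k) = 0 := by
    intro i j k
    rw [← LinearMap.add_apply, ← map_add, hAa, hAa, ← Finset.sum_add_distrib]
    simp [← add_smul, B_antisymm]
  have swap_right : ∀ i j k, Ω (A i (a j)) (a k) = Ω (A i (a k)) (a j) := by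
    intro i j k
    have h₁ := hskew i (a j) (a k)
    have h₂ := hAlt.neg_eq (a j) (A i (a k))
    linarith
  have pairing_zero : ∀ i j k, Ω (A i (a j)) (a k) = 0 := by
    intro i j k
    linarith [swap_left i j k, swap_left j k i, swap_left k i j,
      swap_right i j k, swap_right j k i, swap_right k i j]
  intro i j
  have hB : B i j = 0 := by
    refine Matrix.vecMul_injective_of_isUnit hGram ?_
    ext k
    simpa [Matrix.vecMul, dotProduct, hAa] using pairing_zero i j k
  simp [hAA, hB]
end

section
/- Let (V, Ω) be a finite-dimensional real symplectic vector space. Let A₁, …, A_m be Ω-skew endomorphisms of V and a₁, …, a_m ∈ V, and suppose there are real constants c^k_{ij} such that Aᵢ∘Aⱼ − Aⱼ∘Aᵢ = Σ_k c^k_{ij} A_k and Aᵢ aⱼ − Aⱼ aᵢ = Σ_k c^k_{ij} a_k for all i, j (i.e. the affine symplectic elements (Aᵢ, aᵢ) span a Lie subalgebra of the affine symplectic algebra). Define Fᵢ(x) := (1/2)Ω(x, Aᵢ x) − Ω(aᵢ, x). If x ∈ V satisfies F_l(x) = 0 for all l = 1, …, m, then Ω(Aⱼ x + aⱼ, A_k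 x + a_k) = Ω(aⱼ, a_k) for all j, k. -/
/-- If the affine symplectic elements `(Aᵢ, aᵢ)` span a Lie subalgebra of the
affine symplectic algebra, `Fᵢ(x) := (1/2)Ω(x, Aᵢx) − Ω(aᵢ, x)`, and `x` is a common zero of
the `F_l`, then `Ω(Aⱼx + aⱼ, A_kx + a_k) = Ω(aⱼ, a_k)` for all `j, k`. -/
theorem omega_fundamental_fields_constant_on_zero_set
    (V : Type*) [AddCommGroup V] [Module ℝ V] [FiniteDimensional ℝ V]
    (Ω : LinearMap.BilinForm ℝ V) (hAlt : Ω.IsAlt) (hNd : Ω.Nondegenerate)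
    (m : ℕ) (A : Fin m → (V →ₗ[ℝ] V)) (a : Fin m → V)
    (hskew : ∀ i, ∀ x y, Ω (A i x) y + Ω x (A i y) = 0)
    (c : Fin m → Fin m → Fin m → ℝ)
    (hAA : ∀ i j, A i ∘ₗ A j - A j ∘ₗ A i = ∑ k, c i j k • A k)
    (hAa : ∀ i j, A i (a j) - A j (a i) = ∑ k, c i j k • a k)
    (x : V)
    (hx : ∀ l, (1/2 : ℝ) * Ω x (A l x) - Ω (a l) x = 0) :
    ∀ j k, Ω (A j x + a j) (A k x + a k) = Ω (a j) (a k) := by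
  intro j k
  have hA : Ω x (A j (A k x)) - Ω x (A k (A j x)) = ∑ l, c j k l * Ω x (A l x) := by
    simpa using congrArg (Ω x) (LinearMap.congr_fun (hAA j k) x)
  have ha : Ω (A j (a k)) x - Ω (A k (a j)) x = ∑ l, c j k l * Ω (a l) x := by
    simpa using congrArg (fun v => Ω v x) (hAa j k)
  have hF : (1/2 : ℝ) * ∑ l, c j k l * Ω x (A l x) = ∑ l, c j k l * Ω (a l) x := by
    rw [Finset.mul_sum]
    refine Finset.sum_congr rfl fun l _ => ?_
    linear_combination c j k l * hx l
  rw [← hA, ← ha] at hF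
  simp only [map_add, LinearMap.add_apply]
  linarith [hskew j x (A k x), hskew k x (A j x), hskew j (a k) x, hskew k (a j) x,
    hAlt.neg_eq (A j x) (A k x), hAlt.neg_eq (A j x) (a k)]
end

section
/- Let (V, Ω) be a finite-dimensional real symplectic vector space. Let A₁, …, A_m be Ω-skew endomorphisms of V, let a₁, …, a_m ∈ V be vectors whose Gram matrix (Ω(aᵢ, aⱼ))ᵢⱼ is invertible, and suppose there are real constants B^k_{ij} with Aᵢ∘Aⱼ = Σ_k B^k_{ij} A_k and Aᵢ aⱼ = Σ_k B^k_{ij} a_k for all i, j. Define Fᵢ(x) := (1/2)Ω(x, Aᵢ x) − Ω(aᵢ, x). Then for every x ∈ V with F_l(x) = 0 for all l, the vectors A₁x + a₁, …, A_m x + a_m are linearly independent, and the linear map V → ℝ^m, v ↦ (Ω(v, A₁x + a₁), …, Ω(v, A_m x + a_m)) (which is, up to sign, the differential at x of the map F = (F₁, …, F_m)) is surjective; hence F is a submersion at every point of its zero set. -/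
/-- A family whose Gram matrix with respect to a bilinear form is invertible is linearly
independent. -/
theorem linearIndependent_of_isUnit_gram {K V ι : Type*} [Field K] [AddCommGroup V] [Module K V]
    [Fintype ι] [DecidableEq ι] (Ω : LinearMap.BilinForm K V) (v : ι → V)
    (h : IsUnit (Matrix.of fun i j => Ω (v i) (v j))) : LinearIndependent K v := by
  rw [Fintype.linearIndependent_iff]
  intro c hc
  refine congrFun (Matrix.mulVec_injective_of_isUnit h (a₁ := c) (a₂ := 0) ?_)
  ext i
  simpa [Matrix.mulVec, dotProduct, mul_comm] using congrArg (Ω (v i)) hc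

/-- If the Gram matrix of a family `v` is invertible, then the pairings with the members of `v` can
be prescribed arbitrarily. -/
theorem surjective_pairing_of_isUnit_gram {K V ι : Type*} [Field K] [AddCommGroup V] [Module K V]
    [Fintype ι] [DecidableEq ι] (Ω : LinearMap.BilinForm K V) (v : ι → V)
    (h : IsUnit (Matrix.of fun i j => Ω (v i) (v j))) :
    Function.Surjective (fun w : V => fun i => Ω w (v i)) := by
  intro b
  obtain ⟨c, hc⟩ := Matrix.vecMul_surjective_iff_isUnit.mpr h b
  refine ⟨∑ j, c j • v j, ?_⟩
  rw [← hc]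
  ext i
  simp [Matrix.vecMul, dotProduct]

/-- At a common zero of the Hamiltonians `F_l`, the affine vector fields `Aᵢ x + aᵢ` have the same
Gram matrix as the `aᵢ`. -/
theorem gram_affine_eq_gram {V ι : Type*} [AddCommGroup V] [Module ℝ V] [Fintype ι]
    (Ω : LinearMap.BilinForm ℝ V) (hAlt : Ω.IsAlt) (A : ι → (V →ₗ[ℝ] V)) (a : ι → V)
    (hskew : ∀ i, ∀ x y, Ω (A i x) y + Ω x (A i y) = 0) (B : ι → ι → ι → ℝ)
    (hAA : ∀ i j, A i ∘ₗ A j = ∑ k, B i j k • A k)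
    (hAa : ∀ i j, A i (a j) = ∑ k, B i j k • a k) (x : V)
    (hx : ∀ l, (1/2 : ℝ) * Ω x (A l x) - Ω (a l) x = 0) (i j : ι) :
    Ω (A i x + a i) (A j x + a j) = Ω (a i) (a j) := by
  have hquad (i j : ι) : Ω (A i x) (A j x) = -2 * Ω (A i (a j)) x := by
    have hcomp : A i (A j x) = ∑ k, B i j k • A k x := by
      simpa using LinearMap.congr_fun (hAA i j) x
    have hsum : Ω x (A i (A j x)) = 2 * Ω (A i (a j)) x := by
      rw [hcomp, hAa]
      simp only [map_sum, map_smul, LinearMap.sum_apply, LinearMap.smul_apply, smul_eq_mul,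
        Finset.mul_sum]
      exact Finset.sum_congr rfl fun k _ => by linear_combination 2 * B i j k * hx k
    linear_combination hskew i x (A j x) - hsum
  simp only [map_add, LinearMap.add_apply]
  linear_combination (hquad i j - hquad j i) / 2 + hskew i x (a j) + hskew j (a i) x
    + hAlt.neg_eq (A i x) (A j x) * (-1 / 2) + hAlt.neg_eq x (A i (a j))


/-- With `Aᵢ∘Aⱼ = Σ_k B^k_{ij} A_k`, `Aᵢaⱼ = Σ_k B^k_{ij} a_k` and invertible
Gram matrix `(Ω(aᵢ,aⱼ))`, at every common zero `x` of the `F_l` the vectors `Aᵢx + aᵢ` are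
linearly independent and `v ↦ (Ω(v, A₁x+a₁), …, Ω(v, A_mx+a_m))` is surjective, i.e. `F` is a
submersion along its zero set. -/
theorem submersion_on_zero_set
    (V : Type*) [AddCommGroup V] [Module ℝ V] [FiniteDimensional ℝ V]
    (Ω : LinearMap.BilinForm ℝ V) (hAlt : Ω.IsAlt) (hNd : Ω.Nondegenerate)
    (m : ℕ) (A : Fin m → (V →ₗ[ℝ] V)) (a : Fin m → V)
    (hskew : ∀ i, ∀ x y, Ω (A i x) y + Ω x (A i y) = 0)
    (hGram : IsUnit (Matrix.of fun i j => Ω (a i) (a j) : Matrix (Fin m) (Fin m) ℝ))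
    (B : Fin m → Fin m → Fin m → ℝ)
    (hAA : ∀ i j, A i ∘ₗ A j = ∑ k, B i j k • A k)
    (hAa : ∀ i j, A i (a j) = ∑ k, B i j k • a k)
    (x : V)
    (hx : ∀ l, (1/2 : ℝ) * Ω x (A l x) - Ω (a l) x = 0) :
    LinearIndependent ℝ (fun i => A i x + a i) ∧
      Function.Surjective (fun v : V => fun i : Fin m => Ω v (A i x + a i)) := by
  have hG : IsUnit (Matrix.of fun i j => Ω (A i x + a i) (A j x + a j)) := by
    simpa only [gram_affine_eq_gram Ω hAlt A a hskew B hAA hAa x hx] using hGram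
  exact ⟨linearIndependent_of_isUnit_gram Ω _ hG, surjective_pairing_of_isUnit_gram Ω _ hG⟩
end

section
/- Let (V, Ω) be a finite-dimensional real symplectic vector space. Let A₁, …, A_m be Ω-skew endomorphisms of V, a₁, …, a_m ∈ V, and suppose there are real constants B^k_{ij} with Aᵢ∘Aⱼ = Σ_k B^k_{ij} A_k and Aᵢ aⱼ = Σ_k B^k_{ij} a_k for all i, j. Fix x ∈ V, let N_x ⊆ V be the linear span of {Aⱼ x + aⱼ : j = 1, …, m}, and let P : V → V be a linear projection (P∘P = P) with kernel N_x and whose range is contained in the Ω-orthogonal complement N_x^⊥ = {v ∈ V : Ω(v, n) = 0 for all n ∈ N_x}. Define Fᵢ(y) := (1/2)Ω(y, Aᵢ y) − Ω(aᵢ, y). Then for every y ∈ V and every i, Fᵢ(y − 2P(y − x)) = Fᵢ(y). In particular, the zero set Σ = {y : Fᵢ(y) = 0 ∀i} is invariant under the affine symplectic symmetry y ↦ y − 2P(y − x) at each of its points x. -/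
/-- The span of the vectors `Aⱼx + aⱼ` is stable under every `Aᵢ`. -/
theorem map_mem_span_of_structure_constants {R V ι : Type*} [CommRing R] [AddCommGroup V]
    [Module R V] [Fintype ι] {A : ι → (V →ₗ[R] V)} {a : ι → V} {B : ι → ι → ι → R}
    (hAA : ∀ i j, A i ∘ₗ A j = ∑ k, B i j k • A k)
    (hAa : ∀ i j, A i (a j) = ∑ k, B i j k • a k) (x : V) (i : ι) {n : V}
    (hn : n ∈ Submodule.span R (Set.range fun j => A j x + a j)) :
    A i n ∈ Submodule.span R (Set.range fun j => A j x + a j) := by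
  induction hn using Submodule.span_induction with
  | mem v hv =>
    obtain ⟨j, rfl⟩ := hv
    have hA : A i (A j x) = ∑ k, B i j k • A k x := by
      simpa using LinearMap.congr_fun (hAA i j) x
    rw [map_add, hA, hAa, ← Finset.sum_add_distrib]
    refine Submodule.sum_mem _ fun k _ => ?_
    rw [← smul_add]
    exact Submodule.smul_mem _ _ (Submodule.subset_span ⟨k, rfl⟩)
  | zero => simp
  | add u v _ _ hu hv => rw [map_add]; exact Submodule.add_mem _ hu hv
  | smul c u _ hu => rw [map_smul]; exact Submodule.smul_mem _ c hu


/-- With `Aᵢ∘Aⱼ = Σ_k B^k_{ij} A_k` and `Aᵢaⱼ = Σ_k B^k_{ij} a_k`, fix `x ∈ V`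
and let `P` be a linear projection with kernel `N_x = span{Aⱼx + aⱼ}` and range contained in
the `Ω`-orthogonal of `N_x`. Then each `Fᵢ` is invariant under the affine symmetry
`y ↦ y − 2P(y − x)`. -/
theorem F_invariant_under_symmetry
    (V : Type*) [AddCommGroup V] [Module ℝ V] [FiniteDimensional ℝ V]
    (Ω : LinearMap.BilinForm ℝ V) (hAlt : Ω.IsAlt) (hNd : Ω.Nondegenerate)
    (m : ℕ) (A : Fin m → (V →ₗ[ℝ] V)) (a : Fin m → V)
    (hskew : ∀ i, ∀ x y, Ω (A i x) y + Ω x (A i y) = 0)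
    (B : Fin m → Fin m → Fin m → ℝ)
    (hAA : ∀ i j, A i ∘ₗ A j = ∑ k, B i j k • A k)
    (hAa : ∀ i j, A i (a j) = ∑ k, B i j k • a k)
    (x : V) (P : V →ₗ[ℝ] V)
    (hproj : P ∘ₗ P = P)
    (hker : LinearMap.ker P = Submodule.span ℝ (Set.range fun j => A j x + a j))
    (hrange : ∀ v : V, ∀ n ∈ Submodule.span ℝ (Set.range fun j => A j x + a j),
      Ω (P v) n = 0) :
    ∀ (y : V) (i : Fin m),
      (1/2 : ℝ) * Ω (y - (2:ℝ) • P (y - x)) (A i (y - (2:ℝ) • P (y - x)))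
          - Ω (a i) (y - (2:ℝ) • P (y - x)) =
        (1/2 : ℝ) * Ω y (A i y) - Ω (a i) y := by
  intro y i
  have hn : y - x - P (y - x) ∈ Submodule.span ℝ (Set.range fun j => A j x + a j) := by
    rw [← hker, LinearMap.mem_ker, map_sub, ← LinearMap.comp_apply, hproj, sub_self]
  have h₁ := hrange (y - x) _ (map_mem_span_of_structure_constants hAA hAa x i hn)
  have h₂ := hrange (y - x) _ (Submodule.subset_span ⟨i, rfl⟩)
  generalize P (y - x) = w at h₁ h₂ ⊢
  have h₃ := hskew i y w
  have h₄ := hAlt.neg_eq (A i y) w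
  have h₅ := hAlt.neg_eq (a i) w
  simp only [map_sub, map_add, map_smul, LinearMap.sub_apply, LinearMap.smul_apply,
    smul_eq_mul] at h₁ h₂ h₃ h₄ h₅ ⊢
  linarith
end

section
/- Let (V, ω) be a finite-dimensional real symplectic vector space and let C₁, C₂ be ω-skew endomorphisms of V such that the pair (C₁, C₂) satisfies the curvature equations (Ea) and (Eb). Then either C₁ and C₂ are linearly dependent (the flat case), or Cᵢ∘Cⱼ = 0 for all i, j ∈ {1, 2}. -/
/-- The endomorphism `u∘v : w ↦ ω(v,w)·u + ω(u,w)·v`. -/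
noncomputable def rond {V : Type*} [AddCommGroup V] [Module ℝ V]
    (ω : LinearMap.BilinForm ℝ V) (u v : V) : V →ₗ[ℝ] V :=
  (ω v).smulRight u + (ω u).smulRight v

section

variable {V : Type*} [AddCommGroup V] [Module ℝ V]

open LinearMap (trace)

/-- `A` and `B` are `ω`-skew and satisfy both curvature equations, written out on vectors. -/
structure IsCurvaturePair (ω : LinearMap.BilinForm ℝ V) (A B : Module.End ℝ V) : Prop where
  alt : ω.IsAlt
  nondegenerate : ω.Nondegenerate
  skew_left : ∀ x y, ω (A x) y = -ω x (A y)
  skew_right : ∀ x y, ω (B x) y = -ω x (B y)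
  curv_left : ∀ x y w,
    ω (B y) w • A (A x) + ω (A (A x)) w • B y - ω (A y) w • A (B x) - ω (A (B x)) w • A y
      - ω (B x) w • A (A y) - ω (A (A y)) w • B x + ω (A x) w • A (B y) + ω (A (B y)) w • A x
      + (ω (A (B y)) x + ω (B (A y)) x) • A w - (2 * ω (A (A y)) x) • B w = 0
  curv_right : ∀ x y w,
    ω (A y) w • B (B x) + ω (B (B x)) w • A y - ω (B y) w • B (A x) - ω (B (A x)) w • B y
      - ω (A x) w • B (B y) - ω (B (B y)) w • A x + ω (B x) w • B (A y) + ω (B (A y)) w • B x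
      + (ω (B (A y)) x + ω (A (B y)) x) • B w - (2 * ω (B (B y)) x) • A w = 0

/-- If the product of a quadratic form and a linear map vanishes identically, so does one of them. -/
theorem LinearMap.eq_zero_or_forall_form_eq_zero {W : Type*} [AddCommGroup W] [Module ℝ W]
    (Q : LinearMap.BilinForm ℝ V) (L : V →ₗ[ℝ] W) (h : ∀ y, Q y y • L y = 0) :
    L = 0 ∨ ∀ y, Q y y = 0 := by
  by_contra! hne
  obtain ⟨hL, y, hy⟩ := hne
  obtain ⟨z, hz⟩ : ∃ z, L z ≠ 0 := by
    by_contra! hz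
    exact hL (LinearMap.ext hz)
  have hLy : L y = 0 := (smul_eq_zero.1 (h y)).resolve_left hy
  have hline : ∀ s : ℝ, Q (z + s • y) (z + s • y) = 0 := fun s =>
    (smul_eq_zero.1 (h _)).resolve_right (by simpa [hLy] using hz)
  have h₀ := hline 0
  have h₁ := hline 1
  have h₂ := hline (-1)
  simp only [map_add, map_smul, LinearMap.add_apply, LinearMap.smul_apply, smul_eq_mul] at h₀ h₁ h₂
  exact hy (by linarith)

theorem LinearMap.trace_nonneg_of_mul_self_eq [FiniteDimensional ℝ V] {P : Module.End ℝ V}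
    (hP : P * P = P) : 0 ≤ trace ℝ V P := by
  have h : IsIdempotentElem P := hP
  rw [(LinearMap.IsIdempotentElem.isProj_range P h).trace]
  positivity

namespace IsCurvaturePair

variable {ω : LinearMap.BilinForm ℝ V} {A B : Module.End ℝ V}

theorem symm (h : IsCurvaturePair ω A B) : IsCurvaturePair ω B A :=
  ⟨h.alt, h.nondegenerate, h.skew_right, h.skew_left, h.curv_right, h.curv_left⟩

theorem form_swap (h : IsCurvaturePair ω A B) (u v : V) : ω u v = -ω v u :=
  (LinearMap.IsAlt.neg h.alt v u).symm

theorem eq_zero_of_forall (h : IsCurvaturePair ω A B) {u : V} (hu : ∀ x, ω u x = 0) : u = 0 :=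
  h.nondegenerate.1 u hu

theorem form_sq_self (h : IsCurvaturePair ω A B) (y : V) : ω (A (A y)) y = 0 := by
  rw [h.skew_left, h.alt, neg_zero]

theorem form_mul_self_swap (h : IsCurvaturePair ω A B) (y : V) :
    ω (B (A y)) y = -ω (A (B y)) y := by
  rw [h.skew_right, h.skew_left, neg_neg, h.form_swap]

theorem eq_zero_of_form_self (h : IsCurvaturePair ω A B) {T : Module.End ℝ V}
    (hT : ∀ x y, ω (T x) y = -ω x (T y)) (h₀ : ∀ y, ω (T y) y = 0) : T = 0 := by
  ext x
  refine h.eq_zero_of_forall fun y => ?_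
  have h₁ := h₀ (x + y)
  have h₂ : ω (T y) x = ω (T x) y := by rw [h.form_swap, hT x y]
  simp only [map_add, LinearMap.add_apply, h₀, h₂] at h₁
  linarith

/-- Evaluating the first curvature equation on `(x, y, y, y)` gives a cubic vector identity. -/
theorem cubic (h : IsCurvaturePair ω A B) (y : V) :
    (4 * ω (B y) y) • A (A y)
      = ω (A y) y • (A (B y) + (3 : ℝ) • B (A y)) + (2 * ω (A (B y)) y) • A y := by
  rw [← sub_eq_zero]
  refine h.eq_zero_of_forall fun x => ?_
  have key := congrArg (fun v => ω v y) (h.curv_left x y y)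
  have hA := h.skew_left
  have hB := h.skew_right
  have e₁ : ω (A (A x)) y = -ω (A (A y)) x := by rw [hA, hA, neg_neg, h.form_swap]
  have e₂ : ω (A (B x)) y = -ω (B (A y)) x := by rw [hA, hB, neg_neg, h.form_swap]
  have e₃ : ω (A x) y = ω (A y) x := by rw [hA, h.form_swap, neg_neg]
  simp only [map_add, map_sub, map_smul, map_zero, LinearMap.add_apply, LinearMap.sub_apply,
    LinearMap.smul_apply, LinearMap.zero_apply, smul_eq_mul, e₁, e₂, e₃, h.form_sq_self] at key ⊢
  linear_combination -key

variable [FiniteDimensional ℝ V]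

/-- An endomorphism that is skew for a nondegenerate form is traceless. -/
theorem _root_.LinearMap.BilinForm.Nondegenerate.trace_eq_zero_of_skew
    (hω : ω.Nondegenerate) {T : Module.End ℝ V} (hT : ∀ x y, ω (T x) y = -ω x (T y)) :
    trace ℝ V T = 0 := by
  have hc : (ω.toDual hω).conj T = (-1 : ℝ) • Module.Dual.transpose (R := ℝ) T := by
    ext f y
    obtain ⟨x, rfl⟩ := (ω.toDual hω).surjective f
    simp [LinearEquiv.conj_apply, Module.Dual.transpose_apply, LinearMap.BilinForm.toDual_def, hT]
  have h := LinearMap.trace_conj' T (ω.toDual hω)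
  rw [hc, map_smul, LinearMap.trace_transpose', smul_eq_mul] at h
  linarith

/-- The contraction of the first curvature equation against an arbitrary endomorphism `M`
with `ω`-adjoint `N`. -/
theorem contraction (h : IsCurvaturePair ω A B) {M N : Module.End ℝ V}
    (hMN : ∀ x y, ω (M x) y = ω x (N y)) :
    B * M * A * A + trace ℝ V (M * B) • (A * A) - A * M * A * B - trace ℝ V (M * A) • (A * B)
      - trace ℝ V (M * A * A) • B - A * A * M * B + trace ℝ V (M * A * B) • A + A * B * M * A
      + A * N * (A * B + B * A) - (2 : ℝ) • (B * N * A * A) = 0 := by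
  have hA := h.skew_left
  have hB := h.skew_right
  ext x
  refine h.eq_zero_of_forall fun w => ?_
  have key : M ∘ₗ ((ω.flip w ∘ₗ B).smulRight (A (A x)) + ω (A (A x)) w • B
      - (ω.flip w ∘ₗ A).smulRight (A (B x)) - ω (A (B x)) w • A
      - ω (B x) w • (A * A) - (ω.flip w ∘ₗ A ∘ₗ A).smulRight (B x) + ω (A x) w • (A * B)
      + (ω.flip w ∘ₗ A ∘ₗ B).smulRight (A x)
      + (ω.flip x ∘ₗ A ∘ₗ B + ω.flip x ∘ₗ B ∘ₗ A).smulRight (A w)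
      - (2 : ℝ) • (ω.flip x ∘ₗ A ∘ₗ A).smulRight (B w)) = 0 := by
    ext y
    rw [LinearMap.comp_apply, LinearMap.zero_apply, ← map_zero M]
    congr 1
    rw [← h.curv_left x y w]
    simp [mul_smul]
  have hs : ∀ (f : V →ₗ[ℝ] ℝ) (v : V), M ∘ₗ f.smulRight v = f.smulRight (M v) := fun f v => by
    ext; simp
  have key' := congrArg (trace ℝ V) key
  simp only [LinearMap.comp_add, LinearMap.comp_sub, LinearMap.comp_smul, hs, map_add, map_sub,
    map_smul, map_zero, LinearMap.trace_smulRight, LinearMap.comp_apply,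
    LinearMap.BilinForm.flip_apply, LinearMap.add_apply, smul_eq_mul] at key'
  simp only [← Module.End.mul_eq_comp, ← mul_assoc] at key'
  have e₁ : ω (A (B (M (A w)))) x = ω (A (N (B (A x)))) w := by
    rw [hA, hB, hMN, hA, h.form_swap w]; ring
  have e₂ : ω (B (A (M (A w)))) x = ω (A (N (A (B x)))) w := by
    rw [hB, hA, hMN, hA, h.form_swap w]; ring
  have e₃ : ω (A (A (M (B w)))) x = ω (B (N (A (A x)))) w := by
    rw [hA, hA, hMN, hB, h.form_swap w]; ring
  rw [e₁, e₂, e₃] at key'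
  simp only [map_add, map_sub, map_smul, LinearMap.add_apply, LinearMap.sub_apply,
    LinearMap.smul_apply, smul_eq_mul, Module.End.mul_apply]
  linear_combination key'

theorem trace_left (h : IsCurvaturePair ω A B) : trace ℝ V A = 0 :=
  h.nondegenerate.trace_eq_zero_of_skew h.skew_left

theorem trace_mul_mul_left (h : IsCurvaturePair ω A B) : trace ℝ V (A * A * A) = 0 :=
  h.nondegenerate.trace_eq_zero_of_skew fun x y => by simp [h.skew_left]

theorem trace_left_mul_right_mul_left (h : IsCurvaturePair ω A B) :
    trace ℝ V (A * B * A) = 0 :=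
  h.nondegenerate.trace_eq_zero_of_skew fun x y => by simp [h.skew_left, h.skew_right]

theorem trace_left_mul_left_mul_right (h : IsCurvaturePair ω A B) :
    trace ℝ V (A * A * B) = 0 := by
  rw [LinearMap.trace_mul_comm, ← LinearMap.trace_mul_comm, mul_assoc, LinearMap.trace_mul_comm]
  exact h.trace_left_mul_right_mul_left

theorem lie_lie (h : IsCurvaturePair ω A B) :
    (2 : ℝ) • (A * B * A) - B * A * A - A * A * B
      = trace ℝ V (A * A) • B - trace ℝ V (A * B) • A := by
  have key := h.contraction (M := 1) (N := 1) fun _ _ => rfl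
  simp only [one_mul, mul_one, h.trace_left, h.symm.trace_left] at key
  rw [← sub_eq_zero, ← key]
  simp only [mul_add, ← mul_assoc]
  module

theorem contraction_left (h : IsCurvaturePair ω A B) :
    (3 : ℝ) • (B * A * A * A) - (3 : ℝ) • (A * A * A * B) + A * B * A * A - A * A * B * A
      + trace ℝ V (A * B) • (A * A) - trace ℝ V (A * A) • (A * B) = 0 := by
  have key := h.contraction (M := A) (N := -A) fun x y => by simp [h.skew_left]
  simp only [h.trace_mul_mul_left, h.trace_left_mul_left_mul_right] at key
  rw [← key]
  simp only [mul_add, mul_neg, neg_mul, ← mul_assoc]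
  module

theorem contraction_right (h : IsCurvaturePair ω A B) :
    (3 : ℝ) • (B * B * A * A) - A * A * B * B - (2 : ℝ) • (A * B * A * B)
      + trace ℝ V (B * B) • (A * A) - trace ℝ V (A * B) • (A * B) = 0 := by
  have key := h.contraction (M := B) (N := -B) fun x y => by simp [h.skew_right]
  rw [LinearMap.trace_mul_comm ℝ B A, h.symm.trace_left_mul_right_mul_left, mul_assoc B A A,
    LinearMap.trace_mul_comm ℝ B (A * A), h.trace_left_mul_left_mul_right] at key
  rw [← key]
  simp only [mul_add, mul_neg, neg_mul, ← mul_assoc]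
  module

/-- The `ω`-adjoint of `contraction_left`. -/
theorem contraction_left_adjoint (h : IsCurvaturePair ω A B) :
    (3 : ℝ) • (A * A * A * B) - (3 : ℝ) • (B * A * A * A) + A * A * B * A - A * B * A * A
      + trace ℝ V (A * B) • (A * A) - trace ℝ V (A * A) • (B * A) = 0 := by
  ext y
  refine h.nondegenerate.2 _ fun x => ?_
  have key := congrArg (fun T : Module.End ℝ V => ω (T x) y) h.contraction_left
  simp only [map_add, map_sub, map_smul, LinearMap.add_apply, LinearMap.sub_apply, map_zero,
    LinearMap.smul_apply, smul_eq_mul, Module.End.mul_apply, LinearMap.zero_apply, h.skew_left,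
    h.skew_right, neg_neg] at key ⊢
  linear_combination key

/-- The `ω`-adjoint of `contraction_right`. -/
theorem contraction_right_adjoint (h : IsCurvaturePair ω A B) :
    (3 : ℝ) • (A * A * B * B) - B * B * A * A - (2 : ℝ) • (B * A * B * A)
      + trace ℝ V (B * B) • (A * A) - trace ℝ V (A * B) • (B * A) = 0 := by
  ext y
  refine h.nondegenerate.2 _ fun x => ?_
  have key := congrArg (fun T : Module.End ℝ V => ω (T x) y) h.contraction_right
  simp only [map_add, map_sub, map_smul, LinearMap.add_apply, LinearMap.sub_apply, map_zero,
    LinearMap.smul_apply, smul_eq_mul, Module.End.mul_apply, LinearMap.zero_apply, h.skew_left,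
    h.skew_right, neg_neg] at key ⊢
  linear_combination key

theorem two_trace_smul_left_mul_left (h : IsCurvaturePair ω A B) :
    (2 * trace ℝ V (A * B)) • (A * A) = trace ℝ V (A * A) • (A * B + B * A) := by
  linear_combination (norm := module) h.contraction_left + h.contraction_left_adjoint

theorem trace_smul_left_mul_left (h : IsCurvaturePair ω A B) :
    trace ℝ V (B * B) • (A * A) = trace ℝ V (A * A) • (B * B) := by
  have e := h.symm.contraction_right
  have e' := h.symm.contraction_right_adjoint
  rw [LinearMap.trace_mul_comm ℝ B A] at e e'
  linear_combination (norm := module) (1 / 2 : ℝ) •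
    (h.contraction_right + h.contraction_right_adjoint - e - e')

/-- If `A` is not isotropic for the trace form, then `B` is proportional to `A`. -/
theorem trace_smul_right_eq (h : IsCurvaturePair ω A B) (ha : trace ℝ V (A * A) ≠ 0) :
    trace ℝ V (A * A) • B = trace ℝ V (A * B) • A := by
  have hlie := h.lie_lie
  have h₁ := h.two_trace_smul_left_mul_left
  have h₂ := h.trace_smul_left_mul_left
  generalize hta : trace ℝ V (A * A) = a at ha hlie h₁ h₂
  generalize trace ℝ V (A * B) = c at hlie h₁
  generalize trace ℝ V (B * B) = b at h₂
  rw [← sub_eq_zero]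
  obtain ⟨D, hD⟩ : ∃ D, D = a • B - c • A := ⟨_, rfl⟩
  rw [← hD]
  have hDskew : ∀ x y, ω (D x) y = -ω x (D y) := fun x y => by
    simp [hD, h.skew_left, h.skew_right]; ring
  have hanti : D * A = -(A * D) := by
    simp only [hD, mul_sub, sub_mul, mul_smul_comm, smul_mul_assoc]
    linear_combination (norm := module) -h₁
  have hsq : D * D = (a * b - c ^ 2) • (A * A) := by
    simp only [hD, mul_sub, sub_mul, mul_smul_comm, smul_mul_assoc]
    linear_combination (norm := module) c • h₁ - a • h₂
  have hAAD : (4 : ℝ) • (A * A * D) = -a • D := by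
    have hcomm : A * D * A = -(A * A * D) := by rw [mul_assoc, hanti, mul_neg, ← mul_assoc]
    have hcomm' : D * A * A = A * A * D := by rw [hanti, neg_mul, hcomm, neg_neg]
    have hB : a • B = D + c • A := by rw [hD]; module
    have e₁ : a • (A * B * A) = A * D * A + c • (A * A * A) := by
      rw [← smul_mul_assoc, ← mul_smul_comm, hB]; simp [mul_add, add_mul]
    have e₂ : a • (B * A * A) = D * A * A + c • (A * A * A) := by
      rw [← smul_mul_assoc, ← smul_mul_assoc, hB]; simp [add_mul]
    have e₃ : a • (A * A * B) = A * A * D + c • (A * A * A) := by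
      rw [← mul_smul_comm, hB]; simp [mul_add]
    have e := congrArg (a • ·) hlie
    simp only [← hD] at e
    rw [hcomm] at e₁
    rw [hcomm'] at e₂
    linear_combination (norm := module) -e + (2 : ℝ) • e₁ - e₂ - e₃
  by_cases hΔ : a * b - c ^ 2 = 0
  · rw [hΔ, zero_smul] at hsq
    have hdD : ∀ y, (ω ∘ₗ D) y y • D y = 0 := fun y => by
      have hantiy : D (A y) = -A (D y) := congrArg (fun T : Module.End ℝ V => T y) hanti
      have hantiDy : D (A (D y)) = -A (D (D y)) :=
        congrArg (fun T : Module.End ℝ V => T (D y)) hanti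
      have hantiAy : D (A (A y)) = -A (D (A y)) :=
        congrArg (fun T : Module.End ℝ V => T (A y)) hanti
      have hsqy : D (D y) = 0 := congrArg (fun T : Module.End ℝ V => T y) hsq
      have hAADy : (4 : ℝ) • A (A (D y)) = -a • D y :=
        congrArg (fun T : Module.End ℝ V => T y) hAAD
      have hDy : ∀ z, D z = a • B z - c • A z := fun z => by simp [hD]
      have I := h.cubic y
      have II := h.symm.cubic y
      rw [h.form_mul_self_swap] at II
      have I' : (4 * ω (D y) y) • A (A y)
          = -(2 * ω (A y) y) • A (D y) + (2 * ω (A (D y)) y) • A y := by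
        simp only [hDy, map_sub, map_smul, LinearMap.sub_apply, LinearMap.smul_apply,
          smul_eq_mul, h.form_sq_self] at hantiy ⊢
        linear_combination (norm := module) a • I + (3 * ω (A y) y) • hantiy
      have II' : ω (D y) y • A (D y) = ω (A (D y)) y • D y := by
        simp only [hDy, map_sub, map_smul, LinearMap.sub_apply, LinearMap.smul_apply,
          smul_eq_mul, h.form_sq_self] at hantiy hsqy ⊢
        linear_combination (norm := module) (-(a ^ 2) / 2) • II - (a * c / 2) • I
          + (2 * ω (A y) y) • hsqy - ((a * ω (B y) y - c * ω (A y) y) / 2) • hantiy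
      have DI := congrArg D I'
      have AII := congrArg A II'
      simp only [map_add, map_smul, hantiAy, hantiDy, hantiy, hsqy, map_neg, map_zero] at DI AII
      have h3a : (3 * a) ≠ 0 := by simpa using ha
      rw [LinearMap.comp_apply, ← smul_eq_zero_iff_right h3a]
      linear_combination (norm := module) (3 * ω (D y) y) • hAADy - (2 : ℝ) • DI - (4 : ℝ) • AII
    rcases LinearMap.eq_zero_or_forall_form_eq_zero _ _ hdD with h0 | h0
    · exact h0
    · exact h.eq_zero_of_form_self hDskew h0
  · exfalso
    have h4 : (4 : ℝ) • (A * A * (A * A)) = -a • (A * A) := by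
      have e := congrArg (· * D) hAAD
      simp only [smul_mul_assoc, mul_assoc A A D, mul_assoc A, hsq, mul_smul_comm] at e
      rw [← smul_right_inj hΔ]
      simp only [mul_assoc]
      linear_combination (norm := module) e
    have hP : ((-4 / a) • (A * A)) * ((-4 / a) • (A * A)) = (-4 / a) • (A * A) := by
      rw [smul_mul_smul_comm]
      have e := congrArg ((4 / a ^ 2) • ·) h4
      simp only [smul_smul] at e
      convert e using 2 <;> field_simp
    have hnn := LinearMap.trace_nonneg_of_mul_self_eq hP
    rw [map_smul, hta, smul_eq_mul, div_mul_cancel₀ _ ha] at hnn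
    linarith

/-- An isotropic `A` is orthogonal to `B` for the trace form. -/
theorem trace_mul_eq_zero (h : IsCurvaturePair ω A B) (ha : trace ℝ V (A * A) = 0) :
    trace ℝ V (A * B) = 0 := by
  by_contra hc
  have hlie := h.lie_lie
  have h₁ := h.two_trace_smul_left_mul_left
  rw [ha, zero_smul, smul_eq_zero_iff_right (by simpa using hc)] at h₁
  rw [ha, mul_assoc B A A, h₁] at hlie
  have e := congrArg (· * B) hlie
  have hP : ((-2 / trace ℝ V (A * B)) • (A * B)) * ((-2 / trace ℝ V (A * B)) • (A * B))
      = (-2 / trace ℝ V (A * B)) • (A * B) := by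
    simp only [mul_zero, zero_mul, zero_smul, sub_zero, zero_sub, smul_mul_assoc, neg_mul] at e
    rw [smul_mul_smul_comm, ← mul_assoc]
    linear_combination (norm := skip) (2 / trace ℝ V (A * B) ^ 2) • e
    match_scalars <;> field_simp <;> ring
  have hnn := LinearMap.trace_nonneg_of_mul_self_eq hP
  rw [map_smul, smul_eq_mul, div_mul_cancel₀ _ hc] at hnn
  linarith

/-- If the trace form vanishes on the span of `A` and `B`, then `A` and `B` commute. -/
theorem mul_comm_of_trace_eq_zero (h : IsCurvaturePair ω A B) (ha : trace ℝ V (A * A) = 0)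
    (hb : trace ℝ V (B * B) = 0) (hc : trace ℝ V (A * B) = 0) : A * B = B * A := by
  have hc' : trace ℝ V (B * A) = 0 := by rw [LinearMap.trace_mul_comm, hc]
  obtain ⟨E, hE⟩ : ∃ E, E = A * B - B * A := ⟨_, rfl⟩
  rw [← sub_eq_zero, ← hE]
  have hlie := h.lie_lie
  have hlie' := h.symm.lie_lie
  have h₁ := h.contraction_left
  have h₁' := h.symm.contraction_left
  have h₂ := h.contraction_right
  have h₃ := h.contraction_right_adjoint
  simp only [ha, hb, hc, hc', zero_smul, add_zero, sub_zero, mul_assoc]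
    at hlie hlie' h₁ h₁' h₂ h₃
  have hAE : A * E = E * A := by
    simp only [hE, mul_sub, sub_mul, mul_assoc]
    linear_combination (norm := module) -hlie
  have hBE : B * E = E * B := by
    simp only [hE, mul_sub, sub_mul, mul_assoc]
    linear_combination (norm := module) hlie'
  have hAB : A * B = B * A + E := by rw [hE]; abel
  have hAE' : ∀ X, A * (E * X) = E * (A * X) := fun X => by rw [← mul_assoc, hAE, mul_assoc]
  have hBE' : ∀ X, B * (E * X) = E * (B * X) := fun X => by rw [← mul_assoc, hBE, mul_assoc]
  have hAB' : ∀ X, A * (B * X) = B * (A * X) + E * X := fun X => by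
    rw [← mul_assoc, hAB, add_mul, mul_assoc]
  simp only [hAB, hAB', mul_add, hAE, hBE, hAE', hBE', smul_add] at h₁ h₁' h₂ h₃
  have hEAA : E * (A * A) = 0 := by
    linear_combination (norm := module) (-1 / 10 : ℝ) • h₁
  have hEE : E * E = 0 := by
    linear_combination (norm := module) (1 / 2 : ℝ) • (h₂ + h₃)
  have hEBA : E * (B * A) = 0 := by
    simp only [hEE] at h₂
    linear_combination (norm := module) (-1 / 10 : ℝ) • h₂
  have hEBB : E * (B * B) = 0 := by
    linear_combination (norm := module) (1 / 10 : ℝ) • h₁'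
  have hEskew : ∀ x y, ω (E x) y = -ω x (E y) := fun x y => by
    simp [hE, h.skew_left, h.skew_right]
  have hform : ∀ y, ω (E y) y = 2 * ω (A (B y)) y := fun y => by
    simp only [hE, LinearMap.sub_apply, Module.End.mul_apply, map_sub, h.form_mul_self_swap]
    ring
  have hE0 : (∀ y, (ω ∘ₗ E) y y = 0) → E = 0 := h.eq_zero_of_form_self hEskew
  have hEAAy : ∀ y, E (A (A y)) = 0 := fun y => congrArg (fun T : Module.End ℝ V => T y) hEAA
  have hEBBy : ∀ y, E (B (B y)) = 0 := fun y => congrArg (fun T : Module.End ℝ V => T y) hEBB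
  have hEBAy : ∀ y, E (B (A y)) = 0 := fun y => congrArg (fun T : Module.End ℝ V => T y) hEBA
  have hEEy : ∀ y, E (E y) = 0 := fun y => congrArg (fun T : Module.End ℝ V => T y) hEE
  have hABy : ∀ y, A (B y) = B (A y) + E y :=
    fun y => congrArg (fun T : Module.End ℝ V => T y) hAB
  have hAEy : ∀ y, A (E y) = E (A y) :=
    fun y => congrArg (fun T : Module.End ℝ V => T y) hAE
  have hBEy : ∀ y, B (E y) = E (B y) :=
    fun y => congrArg (fun T : Module.End ℝ V => T y) hBE
  have hEABy : ∀ y, E (A (B y)) = 0 := fun y => by rw [hABy, map_add, hEBAy, hEEy, add_zero]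
  have hEA : E * A = 0 := by
    refine (LinearMap.eq_zero_or_forall_form_eq_zero (ω ∘ₗ E) (E * A) fun y => ?_).elim id
      fun h0 => by rw [hE0 h0, zero_mul]
    have e := congrArg E (h.cubic y)
    simp only [map_add, map_smul, hEAAy, hEABy, hEBAy, ← hform] at e
    rw [LinearMap.comp_apply, Module.End.mul_apply]
    linear_combination (norm := module) -e
  have hEB : E * B = 0 := by
    refine (LinearMap.eq_zero_or_forall_form_eq_zero (ω ∘ₗ E) (E * B) fun y => ?_).elim id
      fun h0 => by rw [hE0 h0, zero_mul]
    have e := congrArg E (h.symm.cubic y)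
    simp only [map_add, map_smul, hEBBy, hEABy, hEBAy, h.form_mul_self_swap, mul_neg, ← hform]
      at e
    rw [LinearMap.comp_apply, Module.End.mul_apply]
    linear_combination (norm := module) e
  have hEAy : ∀ y, E (A y) = 0 := fun y => congrArg (fun T : Module.End ℝ V => T y) hEA
  have hEBy : ∀ y, E (B y) = 0 := fun y => congrArg (fun T : Module.End ℝ V => T y) hEB
  refine (LinearMap.eq_zero_or_forall_form_eq_zero (ω ∘ₗ E) E fun y => ?_).elim id hE0
  have e := congrArg B (h.cubic y)
  have e' := congrArg A (h.symm.cubic y)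
  simp only [map_add, map_smul, h.form_mul_self_swap, mul_neg, ← hform] at e e'
  simp only [hABy, map_add, hAEy, hBEy, hEAy, hEBy, add_zero] at e e'
  rw [LinearMap.comp_apply]
  linear_combination (norm := module) e + e'

/-- If the trace form vanishes on the span of two linearly independent endomorphisms, then all
their products vanish. -/
theorem mul_eq_zero_of_trace_eq_zero (h : IsCurvaturePair ω A B)
    (hli : ∀ s t : ℝ, s • A + t • B = 0 → s = 0 ∧ t = 0) (ha : trace ℝ V (A * A) = 0)
    (hb : trace ℝ V (B * B) = 0) (hc : trace ℝ V (A * B) = 0) :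
    A * A = 0 ∧ A * B = 0 ∧ B * A = 0 ∧ B * B = 0 := by
  have hcomm := h.mul_comm_of_trace_eq_zero ha hb hc
  have hcommy : ∀ y, B (A y) = A (B y) :=
    fun y => congrArg (fun T : Module.End ℝ V => T y) hcomm.symm
  have he : ∀ y, ω (A (B y)) y = 0 := fun y => by
    have e := h.form_mul_self_swap y
    rw [hcommy] at e
    linarith
  have I : ∀ y, ω (B y) y • A (A y) = ω (A y) y • A (B y) := fun y => by
    have e := h.cubic y
    rw [he, hcommy] at e
    linear_combination (norm := module) (1 / 4 : ℝ) • e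
  have II : ∀ y, ω (A y) y • B (B y) = ω (B y) y • A (B y) := fun y => by
    have e := h.symm.cubic y
    rw [hcommy, he] at e
    linear_combination (norm := module) (1 / 4 : ℝ) • e
  have hA : A ≠ 0 := fun h0 => one_ne_zero (hli 1 0 (by simp [h0])).1
  have key : ∀ T : Module.End ℝ V, (∀ y, ω (A y) y • T y = 0) → T = 0 := fun T hT =>
    (LinearMap.eq_zero_or_forall_form_eq_zero (ω ∘ₗ A) T hT).resolve_right
      fun h0 => hA (h.eq_zero_of_form_self h.skew_left h0)
  have hAA : A * A = 0 := key _ fun x => by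
    obtain ⟨T, hT⟩ : ∃ T : Module.End ℝ V, T = ω (A x) x • B - ω (B x) x • A := ⟨_, rfl⟩
    have hTy : ∀ y, (ω ∘ₗ T) y y • ω (A (A x)) y = 0 := fun y => by
      have e₁ := congrArg (ω x) (I y)
      have e₂ := congrArg (fun v => ω v y) (I x)
      simp only [map_smul, LinearMap.smul_apply, smul_eq_mul, h.skew_left, h.skew_right, neg_neg,
        hcommy] at e₁ e₂
      simp only [LinearMap.comp_apply, hT, LinearMap.sub_apply, LinearMap.smul_apply, map_sub,
        map_smul, smul_eq_mul, h.skew_left, h.skew_right, neg_neg]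
      linear_combination ω y (A y) * e₂ - ω x (A x) * e₁
    rcases LinearMap.eq_zero_or_forall_form_eq_zero (ω ∘ₗ T) (ω (A (A x))) hTy with h0 | h0
    · have hAAx : A (A x) = 0 := h.eq_zero_of_forall fun y => by rw [h0, LinearMap.zero_apply]
      rw [Module.End.mul_apply, hAAx, smul_zero]
    · have hT0 := h.eq_zero_of_form_self
        (fun u v => by simp [hT, h.skew_left, h.skew_right]; ring) h0
      have hAx := (hli (-ω (B x) x) (ω (A x) x) (by rw [← hT0, hT]; module)).2
      rw [hAx, zero_smul]
  have hAB : A * B = 0 := key _ fun y => by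
    rw [Module.End.mul_apply, ← I, ← Module.End.mul_apply, hAA, LinearMap.zero_apply, smul_zero]
  have hBB : B * B = 0 := key _ fun y => by
    rw [Module.End.mul_apply, II, ← Module.End.mul_apply, hAB, LinearMap.zero_apply, smul_zero]
  exact ⟨hAA, hAB, hcomm ▸ hAB, hBB⟩

end IsCurvaturePair

end

/-- If `ω`-skew `C₁, C₂` satisfy the curvature equations (Ea) and (Eb), then
either they are linearly dependent (flat case), or all products `Cᵢ∘Cⱼ` vanish. -/
theorem codim_two_dichotomy
    (V : Type*) [AddCommGroup V] [Module ℝ V] [FiniteDimensional ℝ V]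
    (ω : LinearMap.BilinForm ℝ V) (hAlt : ω.IsAlt) (hNd : ω.Nondegenerate)
    (C₁ C₂ : V →ₗ[ℝ] V)
    (h₁ : ∀ x y, ω (C₁ x) y + ω x (C₁ y) = 0)
    (h₂ : ∀ x y, ω (C₂ x) y + ω x (C₂ y) = 0)
    (hEa : ∀ x y : V,
      rond ω (C₁ (C₁ x)) (C₂ y) - rond ω (C₁ (C₂ x)) (C₁ y)
        - rond ω (C₁ (C₁ y)) (C₂ x) + rond ω (C₁ (C₂ y)) (C₁ x)
        + ω ((C₁ ∘ₗ C₂ + C₂ ∘ₗ C₁) y) x • C₁ - (2 * ω (C₁ (C₁ y)) x) • C₂ = 0)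
    (hEb : ∀ x y : V,
      rond ω (C₂ (C₁ x)) (C₂ y) - rond ω (C₂ (C₂ x)) (C₁ y)
        - rond ω (C₂ (C₁ y)) (C₂ x) + rond ω (C₂ (C₂ y)) (C₁ x)
        + (2 * ω (C₂ (C₂ y)) x) • C₁ - ω ((C₂ ∘ₗ C₁ + C₁ ∘ₗ C₂) y) x • C₂ = 0) :
    ¬ LinearIndependent ℝ ![C₁, C₂] ∨
      (C₁ ∘ₗ C₁ = 0 ∧ C₁ ∘ₗ C₂ = 0 ∧ C₂ ∘ₗ C₁ = 0 ∧ C₂ ∘ₗ C₂ = 0) := by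
  have h : IsCurvaturePair ω C₁ C₂ :=
    { alt := hAlt
      nondegenerate := hNd
      skew_left := fun x y => eq_neg_of_add_eq_zero_left (h₁ x y)
      skew_right := fun x y => eq_neg_of_add_eq_zero_left (h₂ x y)
      curv_left := fun x y w => by
        have e := congrArg (fun T : V →ₗ[ℝ] V => T w) (hEa x y)
        simp only [rond, LinearMap.add_apply, LinearMap.sub_apply, LinearMap.smul_apply,
          LinearMap.smulRight_apply, LinearMap.comp_apply, LinearMap.zero_apply, map_add] at e
        linear_combination (norm := module) e
      curv_right := fun x y w => by
        have e := congrArg (fun T : V →ₗ[ℝ] V => T w) (hEb x y)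
        simp only [rond, LinearMap.add_apply, LinearMap.sub_apply, LinearMap.smul_apply,
          LinearMap.smulRight_apply, LinearMap.comp_apply, LinearMap.zero_apply, map_add] at e
        linear_combination (norm := module) -e }
  refine or_iff_not_imp_left.2 fun hli => ?_
  rw [not_not, LinearIndependent.pair_iff] at hli
  have ha : LinearMap.trace ℝ V (C₁ * C₁) = 0 := by
    by_contra ha
    exact ha (hli (-LinearMap.trace ℝ V (C₁ * C₂)) _
      (by rw [h.trace_smul_right_eq ha]; module)).2
  have hb : LinearMap.trace ℝ V (C₂ * C₂) = 0 := by
    by_contra hb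
    exact hb (hli _ (-LinearMap.trace ℝ V (C₂ * C₁))
      (by rw [h.symm.trace_smul_right_eq hb]; module)).1
  exact h.mul_eq_zero_of_trace_eq_zero hli ha hb (h.trace_mul_eq_zero ha)
end

section
/- Let (V, ω) be a finite-dimensional real symplectic vector space and let C₁, C₂ be linearly independent ω-skew endomorphisms of V such that the pair (C₁, C₂) satisfies the curvature equations (Ea) and (Eb). Then every real linear combination a·C₁ + b·C₂ is a nilpotent endomorphism of V. -/
/-- The trace of a composite with `u∘v`. -/
theorem trace_mul_rond {V : Type*} [AddCommGroup V] [Module ℝ V] [FiniteDimensional ℝ V]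
    (ω : LinearMap.BilinForm ℝ V) (D : Module.End ℝ V) (u v : V) :
    LinearMap.trace ℝ V (D * rond ω u v) = ω v (D u) + ω u (D v) := by
  have h : D * rond ω u v = (ω v).smulRight (D u) + (ω u).smulRight (D v) := by
    ext w
    simp [rond]
  rw [h, map_add, LinearMap.trace_smulRight, LinearMap.trace_smulRight]

/-- The identity obtained from a curvature equation by composing with an arbitrary
`ω`-skew endomorphism `D` and taking traces. -/
def TraceIdentity {V : Type*} [AddCommGroup V] [Module ℝ V]
    (ω : LinearMap.BilinForm ℝ V) (E A B : Module.End ℝ V) : Prop :=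
  ∀ D : Module.End ℝ V, (∀ x y, ω (D x) y = -ω x (D y)) →
    (2 : ℝ) • (A * (E * D - D * E) * B - B * (E * D - D * E) * A) =
      LinearMap.trace ℝ V (A * D) • (E * B + B * E) -
        LinearMap.trace ℝ V (B * D) • (E * A + A * E)

theorem traceIdentity_of_curvature {V : Type*} [AddCommGroup V] [Module ℝ V]
    [FiniteDimensional ℝ V] {ω : LinearMap.BilinForm ℝ V} (hAlt : ω.IsAlt)
    (hNd : ω.Nondegenerate) {E A B : Module.End ℝ V}
    (hE : ∀ x y, ω (E x) y = -ω x (E y)) (hA : ∀ x y, ω (A x) y = -ω x (A y))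
    (hB : ∀ x y, ω (B x) y = -ω x (B y))
    (h : ∀ x y : V,
      rond ω (E (A x)) (B y) - rond ω (E (B x)) (A y)
        - rond ω (E (A y)) (B x) + rond ω (E (B y)) (A x)
        + ω ((E * B + B * E) y) x • A - ω ((E * A + A * E) y) x • B = 0) :
    TraceIdentity ω E A B := by
  intro D hD
  ext y
  refine sub_eq_zero.mp (hNd.2 _ fun x => ?_)
  have key := congrArg (fun T => LinearMap.trace ℝ V (D * T)) (h x y)
  simp only [mul_add, mul_sub, map_add, map_sub, trace_mul_rond, mul_smul_comm, map_smul,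
    smul_eq_mul, mul_zero, map_zero, LinearMap.add_apply, Module.End.mul_apply]
    at key
  rw [LinearMap.trace_mul_comm ℝ D A, LinearMap.trace_mul_comm ℝ D B] at key
  have swap : ∀ u v, ω u v = -ω v u := fun u v => (hAlt.neg_eq v u).symm
  rw [swap (B y), swap (A y), swap (E (A y)), swap (E (B y)), swap (E (B y)),
    swap (B (E y)), swap (E (A y)), swap (A (E y))] at key
  simp only [hA, hB, hD, hE] at key
  simp only [LinearMap.sub_apply, LinearMap.smul_apply, Module.End.mul_apply,
    LinearMap.add_apply, map_sub, map_add, map_smul, smul_eq_mul]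
  linarith

theorem TraceIdentity.change_basis {V : Type*} [AddCommGroup V] [Module ℝ V]
    {ω : LinearMap.BilinForm ℝ V} {A B : Module.End ℝ V}
    (hA : TraceIdentity ω A A B) (hB : TraceIdentity ω B A B) (a b c d : ℝ) :
    TraceIdentity ω (a • A + b • B) (a • A + b • B) (c • A + d • B) := by
  intro D hD
  have h₁ := hA D hD
  have h₂ := hB D hD
  simp only [mul_add, add_mul, mul_sub, sub_mul, smul_mul_assoc, mul_smul_comm, map_add, map_smul,
    smul_eq_mul] at h₁ h₂ ⊢
  linear_combination (norm := module) (a * (a * d - b * c)) • h₁ + (b * (a * d - b * c)) • h₂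

/-- An endomorphism whose positive powers are all traceless is nilpotent. -/
theorem isNilpotent_of_forall_trace_pow_eq_zero {K V : Type*} [Field K] [CharZero K]
    [AddCommGroup V] [Module K V] [FiniteDimensional K V] {S : Module.End K V}
    (h : ∀ k, LinearMap.trace K V (S ^ (k + 1)) = 0) : IsNilpotent S := by
  obtain ⟨g, hg, hX⟩ := Polynomial.exists_eq_pow_rootMultiplicity_mul_and_not_dvd
    (minpoly K S) (minpoly.ne_zero (Algebra.IsIntegral.isIntegral S)) 0
  set m := Polynomial.rootMultiplicity 0 (minpoly K S)
  rw [map_zero, sub_zero] at hg hX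
  obtain ⟨u, v, huv⟩ : IsCoprime (Polynomial.X ^ (m + 1)) g :=
    ((Polynomial.irreducible_X.coprime_iff_not_dvd).2 hX).pow_left
  have huv' : Polynomial.aeval S u * S ^ (m + 1) +
      Polynomial.aeval S v * Polynomial.aeval S g = 1 := by
    simpa using congrArg (Polynomial.aeval S) huv
  have hvg : S ^ m * (Polynomial.aeval S v * Polynomial.aeval S g) = 0 := by
    have := congrArg (Polynomial.aeval S)
      (show Polynomial.X ^ m * (v * g) = v * (Polynomial.X ^ m * g) by ring)
    rw [← hg, map_mul _ _ (minpoly K S), minpoly.aeval, mul_zero] at this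
    simpa using this
  have hidem : IsIdempotentElem (Polynomial.aeval S u * S ^ (m + 1)) := by
    have hz := congrArg (Polynomial.aeval S)
      (show v * g * (u * Polynomial.X ^ (m + 1)) = v * u * Polynomial.X * (Polynomial.X ^ m * g) by
        ring)
    rw [← hg, map_mul _ _ (minpoly K S), minpoly.aeval, mul_zero] at hz
    simp only [map_mul, map_pow, Polynomial.aeval_X] at hz
    rw [IsIdempotentElem]
    nth_rw 1 [eq_sub_of_add_eq huv']
    rw [sub_mul, hz, one_mul, sub_zero]
  have htr : LinearMap.trace K V (Polynomial.aeval S u * S ^ (m + 1)) = 0 := by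
    rw [Polynomial.aeval_eq_sum_range, Finset.sum_mul, map_sum]
    refine Finset.sum_eq_zero fun i _ => ?_
    rw [smul_mul_assoc, ← pow_add, map_smul, ← add_assoc, h, smul_zero]
  rw [LinearMap.IsIdempotentElem.eq_zero_of_trace_eq_zero hidem htr, zero_add] at huv'
  rw [huv', mul_one] at hvg
  exact ⟨m, hvg⟩

theorem eq_zero_of_skew_of_forall_apply_self {V : Type*} [AddCommGroup V] [Module ℝ V]
    {ω : LinearMap.BilinForm ℝ V} (hAlt : ω.IsAlt) (hNd : ω.Nondegenerate)
    {M : Module.End ℝ V} (hM : ∀ x y, ω (M x) y = -ω x (M y)) (h : ∀ v, ω v (M v) = 0) :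
    M = 0 := by
  ext w
  refine hNd.2 _ fun v => ?_
  have h₁ := h (v + w)
  simp only [map_add, LinearMap.add_apply, h] at h₁
  have h₂ := hAlt.neg_eq w (M v)
  have h₃ := hM v w
  linarith

theorem isNilpotent_of_sq_mul_sq {V : Type*} [AddCommGroup V] [Module ℝ V]
    [FiniteDimensional ℝ V] {A : Module.End ℝ V}
    (h : A ^ 4 = (-(LinearMap.trace ℝ V (A ^ 2)) / 4) • A ^ 2) : IsNilpotent A := by
  by_cases ht : LinearMap.trace ℝ V (A ^ 2) = 0
  · exact ⟨4, by rw [h, ht]; simp⟩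
  exfalso
  set t := LinearMap.trace ℝ V (A ^ 2) with ht'
  have hP : IsIdempotentElem ((-4 / t) • A ^ 2) := by
    rw [IsIdempotentElem, smul_mul_smul_comm, ← pow_add, h, smul_smul]
    congr 1
    field_simp
  have := (LinearMap.IsIdempotentElem.isProj_range _ hP).trace
  rw [map_smul, ← ht', smul_eq_mul, div_mul_cancel₀ _ ht] at this
  have h0 : (0 : ℝ) ≤ -4 := this ▸ Nat.cast_nonneg _
  norm_num at h0

section Anticommuting

variable {V : Type*} [AddCommGroup V] [Module ℝ V]
  {ω : LinearMap.BilinForm ℝ V} {A B : Module.End ℝ V}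

theorem traceIdentity_anticomm (hBA : B * A = -(A * B)) (h : TraceIdentity ω A A B)
    {D : Module.End ℝ V} (hD : ∀ x y, ω (D x) y = -ω x (D y)) :
    A * (A * D - D * A) * B - B * (A * D - D * A) * A =
      -(LinearMap.trace ℝ V (B * D) • A ^ 2) := by
  have := h D hD
  rw [hBA, add_neg_cancel, smul_zero, ← two_smul ℝ (A * A), smul_comm, zero_sub, ← smul_neg] at this
  simpa [pow_two] using smul_right_injective _ (two_ne_zero (α := ℝ)) this

variable [FiniteDimensional ℝ V]

theorem isNilpotent_or_sq_mul_sq_eq_zero (hA : ∀ x y, ω (A x) y = -ω x (A y))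
    (hB : ∀ x y, ω (B x) y = -ω x (B y)) (hBA : B * A = -(A * B))
    (h : TraceIdentity ω A A B) : IsNilpotent A ∨ A ^ 2 * B ^ 2 = 0 := by
  have hBA' : ∀ X, B * (A * X) = -(A * (B * X)) := fun X => by
    rw [← mul_assoc, hBA, neg_mul, mul_assoc]
  have h₁ := traceIdentity_anticomm hBA h hB
  have h₂ := traceIdentity_anticomm hBA h (D := A ^ 2 * B) fun x y => by
    have hc : B * A ^ 2 = A ^ 2 * B := by simp [pow_two, hBA, hBA', mul_assoc]
    rw [← hc]
    simp only [pow_two, Module.End.mul_apply, hA, hB, neg_neg]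
    rw [← Module.End.mul_apply A A, ← pow_two, ← Module.End.mul_apply, ← hc]
    simp only [pow_two, Module.End.mul_apply]
  have e₁ : (4 : ℝ) • (A ^ 2 * B ^ 2) = -(LinearMap.trace ℝ V (B * B) • A ^ 2) := by
    rw [← h₁]
    simp only [pow_two, mul_sub, sub_mul, mul_assoc, hBA, hBA', mul_neg, neg_mul, neg_neg]
    module
  have e₂ : (4 : ℝ) • (A ^ 4 * B ^ 2) =
      -(LinearMap.trace ℝ V (A ^ 2 * B ^ 2) • A ^ 2) := by
    have : B * (A ^ 2 * B) = A ^ 2 * B ^ 2 := by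
      simp [pow_two, hBA', mul_assoc]
    rw [← this, ← h₂]
    simp only [pow_succ, pow_zero, one_mul, mul_sub, sub_mul, mul_assoc, hBA, hBA', mul_neg, neg_mul, neg_neg]
    module
  by_cases hc : LinearMap.trace ℝ V (B * B) = 0
  · right
    rw [hc, zero_smul, neg_zero] at e₁
    exact (smul_eq_zero.mp e₁).resolve_left (by norm_num)
  · left
    refine isNilpotent_of_sq_mul_sq ?_
    have e₃ := congrArg (LinearMap.trace ℝ V) e₁
    simp only [map_smul, map_neg, smul_eq_mul] at e₃
    have e₄ : (4 : ℝ) • (A ^ 4 * B ^ 2) = -(LinearMap.trace ℝ V (B * B) • A ^ 4) := by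
      rw [show A ^ 4 = A ^ 2 * A ^ 2 by rw [← pow_add], mul_assoc, ← mul_smul_comm, e₁, mul_neg,
        mul_smul_comm]
    rw [e₂, neg_inj] at e₄
    refine smul_right_injective _ hc ?_
    simp only [← e₄, smul_smul]
    congr 1
    linarith

theorem isNilpotent_of_anticomm (hAlt : ω.IsAlt) (hNd : ω.Nondegenerate)
    (hA : ∀ x y, ω (A x) y = -ω x (A y))
    (hB : ∀ x y, ω (B x) y = -ω x (B y)) (hBA : B * A = -(A * B)) (hB0 : B ≠ 0)
    (h : TraceIdentity ω A A B) : IsNilpotent A := by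
  refine (isNilpotent_or_sq_mul_sq_eq_zero hA hB hBA h).elim id fun hAABB => ?_
  have hBA' : ∀ x, B (A x) = -A (B x) := fun x => congrArg (fun T => T x) hBA
  have swap : ∀ u v, ω u v = -ω v u := fun u v => (hAlt.neg_eq v u).symm
  have hrank : ∀ u x y, ω ((ω u).smulRight u x) y = -ω x ((ω u).smulRight u y) := fun u x y => by
    simp only [LinearMap.smulRight_apply, map_smul, LinearMap.smul_apply, smul_eq_mul]
    rw [swap x u]
    ring
  have htr : ∀ u, LinearMap.trace ℝ V (B * (ω u).smulRight u) = ω u (B u) := fun u => by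
    have : B * (ω u).smulRight u = (ω u).smulRight (B u) := by
      ext w
      simp
    rw [this, LinearMap.trace_smulRight]
  obtain ⟨N, hNcomm, hNadj, hNker⟩ : ∃ N : ℕ, Commute B (A ^ N) ∧
      (∀ x y, ω ((A ^ N) x) y = ω x ((A ^ N) y)) ∧
      ∀ j x, (A ^ (j + N)) x = 0 → (A ^ N) x = 0 := by
    refine ⟨2 * Module.finrank ℝ V, ?_, ?_, ?_⟩
    · rw [pow_mul]
      refine Commute.pow_right ?_ _
      rw [Commute, SemiconjBy, pow_two, ← mul_assoc, hBA, neg_mul, mul_assoc, hBA, mul_neg, neg_neg,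
        mul_assoc]
    · rw [pow_mul]
      induction Module.finrank ℝ V with
      | zero => simp
      | succ n ih =>
        intro x y
        have e : ((A ^ 2) ^ (n + 1)) y = (A ^ 2) (((A ^ 2) ^ n) y) := by
          rw [pow_succ' (A ^ 2) n, Module.End.mul_apply]
        rw [e, pow_succ (A ^ 2) n, Module.End.mul_apply, ih]
        simp only [pow_two A, Module.End.mul_apply, hA, neg_neg]
    · intro j x hx
      rw [← LinearMap.mem_ker] at hx ⊢
      rwa [Module.End.ker_pow_eq_ker_pow_finrank_of_le (by omega)] at hx ⊢
  have hNB : ∀ x, B ((A ^ N) x) = (A ^ N) (B x) := fun x => congrArg (fun T => T x) hNcomm.eq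
  have hvec : ∀ u, A (A (A (((2 * ω u (B u)) • A (B u)) + ω u (A (B u)) • B u))) = 0 := by
    intro u
    have h₁ := congrArg (fun T => A (A (B (T u)))) (traceIdentity_anticomm hBA h (hrank u))
    have h₂ : ω u (A (A u)) = 0 := by
      have := hA u (A u)
      rw [hAlt (A u)] at this
      linarith
    have h₃ : A (A (B (B (A u)))) = 0 := by
      simpa [pow_two] using congrArg (fun T => T (A u)) hAABB
    simp only [htr, pow_two, Module.End.mul_apply, LinearMap.sub_apply, LinearMap.neg_apply,
      LinearMap.smul_apply, LinearMap.smulRight_apply, map_sub, map_smul, map_neg, h₂, h₃, zero_smul,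
      smul_zero, map_zero] at h₁
    simp only [hBA', map_neg] at h₁
    simp only [map_add, map_smul]
    linear_combination (norm := module) h₁
  have hq : ∀ v, ω ((A ^ N) v) (B ((A ^ N) v)) = 0 := by
    intro v
    by_contra hb
    have h₁ := hvec ((A ^ N) v)
    set u := (A ^ N) v with hu
    have hpow : ∀ x, (A ^ N) (A x) = A ((A ^ N) x) := fun x => by
      rw [← Module.End.mul_apply, ← pow_succ, pow_succ', Module.End.mul_apply]
    have h₂ : (2 * ω u (B u)) • A (B u) + ω u (A (B u)) • B u = 0 := by
      have := hNker 3 ((2 * ω u (B u)) • A (B v) + ω u (A (B u)) • B v) (by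
        rw [pow_add, Module.End.mul_apply]
        simp only [map_add, map_smul, hpow, ← hNB, ← hu]
        simpa [pow_succ] using h₁)
      simpa only [map_add, map_smul, hpow, ← hNB, ← hu] using this
    have h₃ := congrArg (ω u) h₂
    simp only [map_add, map_smul, smul_eq_mul, map_zero] at h₃
    have h₄ : ω u (A (B u)) = 0 := by
      have : ω u (B u) * ω u (A (B u)) = 0 := by linarith
      exact (mul_eq_zero.mp this).resolve_left hb
    rw [h₄, zero_smul, add_zero] at h₂
    have h₅ : A (B u) = 0 := (smul_eq_zero.mp h₂).resolve_left (by simpa using hb)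
    have h₆ : (A ^ N) (B v) = 0 := hNker 1 _ (by
      rw [pow_add, Module.End.mul_apply, ← hNB, ← hu, pow_one, h₅])
    rw [← hNB] at h₆
    rw [hu, h₆, map_zero] at hb
    exact hb rfl
  have hM : A ^ N * B * A ^ N = 0 := by
    refine eq_zero_of_skew_of_forall_apply_self hAlt hNd (fun x y => ?_) fun v => ?_
    · simp only [Module.End.mul_apply, hNadj, hB]
    · simp only [Module.End.mul_apply, ← hNadj, hq]
  have hANB : A ^ N * B = 0 := by
    ext v
    refine hNker N _ ?_
    have := congrArg (fun T => T v) hM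
    rw [pow_add]
    simpa only [Module.End.mul_apply, hNB, LinearMap.zero_apply] using this
  have hBAN : B * A ^ N = 0 := hNcomm.eq.trans hANB
  obtain ⟨u, hu⟩ : ∃ u, ω u (B u) ≠ 0 := by
    by_contra! hall
    exact hB0 (eq_zero_of_skew_of_forall_apply_self hAlt hNd hB hall)
  have h₁ := congrArg (fun T => A ^ N * T * A ^ N) (traceIdentity_anticomm hBA h (hrank u))
  simp only [mul_sub, sub_mul, mul_assoc, hBAN, mul_zero] at h₁
  simp only [← mul_assoc, hANB, zero_mul, sub_zero, htr, mul_neg, neg_mul, mul_smul_comm,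
    smul_mul_assoc] at h₁
  rw [eq_comm, neg_eq_zero, smul_eq_zero, ← pow_add, ← pow_add] at h₁
  exact ⟨_, h₁.resolve_left hu⟩

end Anticommuting

theorem isNilpotent_of_traceIdentity {V : Type*} [AddCommGroup V] [Module ℝ V]
    [FiniteDimensional ℝ V] {ω : LinearMap.BilinForm ℝ V} (hAlt : ω.IsAlt)
    (hNd : ω.Nondegenerate) {A B : Module.End ℝ V} (hA : ∀ x y, ω (A x) y = -ω x (A y))
    (hB : ∀ x y, ω (B x) y = -ω x (B y)) (hAB : ∀ r : ℝ, B ≠ r • A)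
    (h : TraceIdentity ω A A B) : IsNilpotent A := by
  by_cases htr : ∀ k, LinearMap.trace ℝ V ((A ^ 2) ^ (k + 1)) = 0
  · exact (isNilpotent_of_forall_trace_pow_eq_zero htr).of_pow
  push Not at htr
  obtain ⟨k, hk⟩ := htr
  have hodd : ∀ x y, ω ((A ^ (2 * k + 1)) x) y = -ω x ((A ^ (2 * k + 1)) y) := by
    clear hk
    induction k with
    | zero => simpa using hA
    | succ n ih =>
      intro x y
      have ex : (A ^ (2 * (n + 1) + 1)) x = (A ^ (2 * n + 1)) (A (A x)) := by
        rw [show 2 * (n + 1) + 1 = 2 * n + 1 + 1 + 1 by ring, pow_succ, pow_succ]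
        rfl
      have ey : (A ^ (2 * (n + 1) + 1)) y = A (A ((A ^ (2 * n + 1)) y)) := by
        rw [show 2 * (n + 1) + 1 = 2 * n + 1 + 1 + 1 by ring, pow_succ', pow_succ']
        rfl
      rw [ex, ey, ih, hA, hA, neg_neg]
  have hD := h _ hodd
  rw [← pow_succ, ← pow_succ', sub_self, mul_zero, mul_zero, zero_mul, zero_mul, sub_zero, smul_zero,
    show 2 * k + 1 + 1 = 2 * (k + 1) by ring, pow_mul] at hD
  set t := LinearMap.trace ℝ V ((A ^ 2) ^ (k + 1))
  set s := LinearMap.trace ℝ V (B * A ^ (2 * k + 1))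
  have hD' : A * B + B * A = (s / t) • (A * A + A * A) := by
    refine smul_right_injective _ hk ?_
    simp only [smul_smul, mul_div_cancel₀ _ hk]
    exact (sub_eq_zero.mp hD.symm)
  refine isNilpotent_of_anticomm (B := B - (s / t) • A) hAlt hNd hA ?_ ?_
    (sub_ne_zero.mpr (hAB _)) ?_
  · intro x y
    simp only [LinearMap.sub_apply, LinearMap.smul_apply, map_sub, map_smul, hA, hB, smul_neg]
    ring
  · simp only [sub_mul, mul_sub, smul_mul_assoc, mul_smul_comm]
    linear_combination (norm := module) hD'
  · intro D hD
    have := h D hD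
    simp only [mul_sub, sub_mul, smul_mul_assoc, mul_smul_comm, map_sub, map_smul, smul_eq_mul]
      at this ⊢
    linear_combination (norm := module) this

/-- If linearly independent `ω`-skew `C₁, C₂` satisfy the curvature
equations (Ea) and (Eb), then every linear combination `a·C₁ + b·C₂` is nilpotent. -/
theorem combinations_nilpotent
    (V : Type*) [AddCommGroup V] [Module ℝ V] [FiniteDimensional ℝ V]
    (ω : LinearMap.BilinForm ℝ V) (hAlt : ω.IsAlt) (hNd : ω.Nondegenerate)
    (C₁ C₂ : V →ₗ[ℝ] V)
    (h₁ : ∀ x y, ω (C₁ x) y + ω x (C₁ y) = 0)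
    (h₂ : ∀ x y, ω (C₂ x) y + ω x (C₂ y) = 0)
    (hli : LinearIndependent ℝ ![C₁, C₂])
    (hEa : ∀ x y : V,
      rond ω (C₁ (C₁ x)) (C₂ y) - rond ω (C₁ (C₂ x)) (C₁ y)
        - rond ω (C₁ (C₁ y)) (C₂ x) + rond ω (C₁ (C₂ y)) (C₁ x)
        + ω ((C₁ ∘ₗ C₂ + C₂ ∘ₗ C₁) y) x • C₁ - (2 * ω (C₁ (C₁ y)) x) • C₂ = 0)
    (hEb : ∀ x y : V,
      rond ω (C₂ (C₁ x)) (C₂ y) - rond ω (C₂ (C₂ x)) (C₁ y)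
        - rond ω (C₂ (C₁ y)) (C₂ x) + rond ω (C₂ (C₂ y)) (C₁ x)
        + (2 * ω (C₂ (C₂ y)) x) • C₁ - ω ((C₂ ∘ₗ C₁ + C₁ ∘ₗ C₂) y) x • C₂ = 0) :
    ∀ a b : ℝ, IsNilpotent (a • C₁ + b • C₂ : Module.End ℝ V) := by
  intro a b
  have hA : ∀ x y, ω (C₁ x) y = -ω x (C₁ y) := fun x y => eq_neg_of_add_eq_zero_left (h₁ x y)
  have hB : ∀ x y, ω (C₂ x) y = -ω x (C₂ y) := fun x y => eq_neg_of_add_eq_zero_left (h₂ x y)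
  have hTA : TraceIdentity ω C₁ C₁ C₂ := traceIdentity_of_curvature hAlt hNd hA hA hB fun x y => by
    have := hEa x y
    rw [two_mul] at this
    simpa using this
  have hTB : TraceIdentity ω C₂ C₁ C₂ := traceIdentity_of_curvature hAlt hNd hB hA hB fun x y => by
    have := hEb x y
    rw [two_mul] at this
    simpa using this
  by_cases hab : a = 0 ∧ b = 0
  · simp [hab.1, hab.2]
  have hskew : ∀ c d : ℝ, ∀ x y, ω ((c • C₁ + d • C₂) x) y = -ω x ((c • C₁ + d • C₂) y) := by
    intro c d x y
    simp only [LinearMap.add_apply, LinearMap.smul_apply, map_add, map_smul, hA, hB, smul_eq_mul]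
    ring
  refine isNilpotent_of_traceIdentity hAlt hNd (hskew a b) (hskew (-b) a) (fun r hr => hab ?_)
    (hTA.change_basis hTB a b (-b) a)
  have h0 := LinearIndependent.pair_iff.mp hli (-b - r * a) (a - r * b) (by
    linear_combination (norm := module) hr)
  have hb : b = -(r * a) := by linarith [h0.1]
  have ha : a * (1 + r ^ 2) = 0 := by
    have := h0.2
    rw [hb] at this
    linarith
  have ha0 : a = 0 := (mul_eq_zero.mp ha).resolve_right (by positivity)
  exact ⟨ha0, by simp [hb, ha0]⟩
end

section
/- Let (V, ω) be a finite-dimensional real symplectic vector space and let C₁, C₂ be ω-skew endomorphisms of V such that the pair (C₁, C₂) satisfies the curvature equations (Ea) and (Eb). Assume that every real linear combination a·C₁ + b·C₂ is nilpotent and that C₁∘C₁ ≠ 0. Then for every C in the linear span of {C₁, C₂}, the kernel of C₁ is contained in the kernel of C. -/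
/-- If `u∘v = 0` for a form with trivial left kernel, then `u = 0` or `v = 0`. -/
theorem eq_zero_or_eq_zero_of_rond_eq_zero {V : Type*} [AddCommGroup V] [Module ℝ V]
    {ω : LinearMap.BilinForm ℝ V} (hω : ω.SeparatingLeft) {u v : V}
    (h : rond ω u v = 0) : u = 0 ∨ v = 0 := by
  refine or_iff_not_imp_right.mpr fun hv => ?_
  obtain ⟨w, hw⟩ : ∃ w, ω v w ≠ 0 := by
    by_contra! hvw
    exact hv (hω v hvw)
  have hrel : ω v w • u + ω u w • v = 0 := by simpa [rond] using LinearMap.congr_fun h w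
  have huw : ω u w = 0 := by
    have hpair := congrArg (fun t => ω t w) hrel
    simp only [map_add, map_smul, LinearMap.add_apply, LinearMap.smul_apply, smul_eq_mul,
      map_zero, LinearMap.zero_apply] at hpair
    exact (mul_eq_zero.mp (by linarith : ω v w * ω u w = 0)).resolve_left hw
  simpa [huw, hw] using hrel

/-- If `A` is nilpotent and `A z ≠ 0`, then `A z` is not in the span of `z` and `A² z`. -/
theorem coeff_eq_zero_of_isNilpotent {K V : Type*} [Field K] [AddCommGroup V]
    [Module K V] {A : Module.End K V} (hA : IsNilpotent A) {z : V} (hz : A z ≠ 0) {a b c : K}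
    (h : a • z + b • A z + c • A (A z) = 0) : b = 0 := by
  classical
  have hex : ∃ n, (A ^ n) (A z) = 0 := by
    obtain ⟨n, hn⟩ := hA
    exact ⟨n, by simp [hn]⟩
  obtain ⟨m, hm⟩ : ∃ m, Nat.find hex = m + 1 :=
    Nat.exists_eq_succ_of_ne_zero fun h0 => hz (by simpa [h0] using Nat.find_spec hex)
  have htop : (A ^ m) (A (A z)) = 0 := by
    simpa [hm, pow_succ] using Nat.find_spec hex
  have hne : (A ^ m) (A z) ≠ 0 := Nat.find_min hex (by omega)
  have hcomm (v : V) : A ((A ^ m) v) = (A ^ m) (A v) := by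
    rw [← Module.End.mul_apply, ← Module.End.mul_apply, ← pow_succ', pow_succ]
  have hlow := congrArg (A ^ m) h
  simp only [map_add, map_smul, map_zero, htop, smul_zero, add_zero] at hlow
  have ha : a = 0 := by
    have hup := congrArg A hlow
    simpa [hcomm, htop, hne] using hup
  simpa [ha, hne] using hlow

/-- If `ω`-skew `C₁, C₂` satisfy the curvature equations, every combination
`a·C₁ + b·C₂` is nilpotent, and `C₁∘C₁ ≠ 0`, then `ker C₁ ⊆ ker C` for every `C` in the span
of `{C₁, C₂}`. -/
theorem ker_C₁_le_ker
    (V : Type*) [AddCommGroup V] [Module ℝ V] [FiniteDimensional ℝ V]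
    (ω : LinearMap.BilinForm ℝ V) (hAlt : ω.IsAlt) (hNd : ω.Nondegenerate)
    (C₁ C₂ : V →ₗ[ℝ] V)
    (h₁ : ∀ x y, ω (C₁ x) y + ω x (C₁ y) = 0)
    (h₂ : ∀ x y, ω (C₂ x) y + ω x (C₂ y) = 0)
    (hEa : ∀ x y : V,
      rond ω (C₁ (C₁ x)) (C₂ y) - rond ω (C₁ (C₂ x)) (C₁ y)
        - rond ω (C₁ (C₁ y)) (C₂ x) + rond ω (C₁ (C₂ y)) (C₁ x)
        + ω ((C₁ ∘ₗ C₂ + C₂ ∘ₗ C₁) y) x • C₁ - (2 * ω (C₁ (C₁ y)) x) • C₂ = 0)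
    (hEb : ∀ x y : V,
      rond ω (C₂ (C₁ x)) (C₂ y) - rond ω (C₂ (C₂ x)) (C₁ y)
        - rond ω (C₂ (C₁ y)) (C₂ x) + rond ω (C₂ (C₂ y)) (C₁ x)
        + (2 * ω (C₂ (C₂ y)) x) • C₁ - ω ((C₂ ∘ₗ C₁ + C₁ ∘ₗ C₂) y) x • C₂ = 0)
    (hnil : ∀ a b : ℝ, IsNilpotent (a • C₁ + b • C₂ : Module.End ℝ V))
    (hC₁sq : C₁ ∘ₗ C₁ ≠ 0) :
    ∀ C ∈ Submodule.span ℝ ({C₁, C₂} : Set (V →ₗ[ℝ] V)),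
      LinearMap.ker C₁ ≤ LinearMap.ker C := by
  intro C hC x hx
  rw [LinearMap.mem_ker] at hx ⊢
  have hA : IsNilpotent (C₁ : Module.End ℝ V) := by simpa using hnil 1 0
  have hskew (u v : V) : ω (C₁ u) v = -ω u (C₁ v) := by linarith [h₁ u v]
  have hskew' (u v : V) : ω (C₂ u) v = -ω u (C₂ v) := by linarith [h₂ u v]
  have key (y w : V) : ω (C₁ y) w • C₁ (C₂ x) + ω (C₁ (C₂ x)) w • C₁ y
      + (ω (C₂ x) w • C₁ (C₁ y) + ω (C₁ (C₁ y)) w • C₂ x)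
      = ω y (C₁ (C₂ x)) • C₁ w := by
    have h := LinearMap.congr_fun (hEa x y) w
    have e₁ : ω (C₁ (C₂ y)) x = 0 := by rw [hskew, hx]; simp
    have e₂ : ω (C₂ (C₁ y)) x = ω y (C₁ (C₂ x)) := by rw [hskew', hskew]; simp
    have e₃ : ω (C₁ (C₁ y)) x = 0 := by rw [hskew, hx]; simp
    simp only [rond, LinearMap.add_apply, LinearMap.sub_apply, LinearMap.smul_apply,
      LinearMap.smulRight_apply, LinearMap.comp_apply, map_add, e₁, e₂, e₃, hx, map_zero,
      LinearMap.zero_apply, zero_smul, smul_zero, mul_zero, zero_add, add_zero, sub_zero] at h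
    linear_combination (norm := module) -h
  have hC₁C₂ : C₁ (C₂ x) = 0 := by
    by_contra hz
    have hc : ω (C₂ x) (C₁ (C₂ x)) = 0 := by
      have h := key (C₂ x) (C₂ x)
      have e : ω (C₁ (C₁ (C₂ x))) (C₂ x) = 0 := by rw [hskew, hAlt, neg_zero]
      rw [hAlt, e, hskew] at h
      have h' : (3 * ω (C₂ x) (C₁ (C₂ x))) • C₁ (C₂ x) = 0 := by
        linear_combination (norm := module) -h
      simpa [hz] using h'
    refine hz (hNd.1 _ fun w => ?_)
    have h := key (C₂ x) w
    rw [hc, zero_smul] at h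
    have hrel : ω (C₁ (C₁ (C₂ x))) w • C₂ x + (2 * ω (C₁ (C₂ x)) w) • C₁ (C₂ x)
        + ω (C₂ x) w • C₁ (C₁ (C₂ x)) = 0 := by
      linear_combination (norm := module) h
    simpa using coeff_eq_zero_of_isNilpotent hA hz hrel
  have hC₂ : C₂ x = 0 := by
    obtain ⟨y, hy⟩ : ∃ y, C₁ (C₁ y) ≠ 0 := by
      by_contra! h
      exact hC₁sq (LinearMap.ext h)
    refine (eq_zero_or_eq_zero_of_rond_eq_zero hNd.1 ?_).resolve_left hy
    ext w
    simpa [rond, hC₁C₂] using key y w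
  obtain ⟨a, b, rfl⟩ := Submodule.mem_span_pair.mp hC
  simp [hx, hC₂]
end

section
/- Let (V, ω) be a finite-dimensional real symplectic vector space and let C₁, C₂ be linearly independent ω-skew endomorphisms of V such that the pair (C₁, C₂) satisfies the curvature equations (Ea) and (Eb). Then C∘C = 0 for every C in the linear span of {C₁, C₂}; in particular C₁∘C₁ = C₂∘C₂ = 0 and C₁∘C₂ + C₂∘C₁ = 0. -/
section

variable {V : Type*} [AddCommGroup V] [Module ℝ V] {ω : LinearMap.BilinForm ℝ V}
  {A B : V →ₗ[ℝ] V}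

/-- The curvature expression in direction `D` for the pair `(A, B)`, with the two slots
`w, z` of the symmetric part and the slot `y` of the alternating part exposed. -/
def curvDefect (ω : LinearMap.BilinForm ℝ V) (A B D : V →ₗ[ℝ] V) (w z y : V) : V :=
  ω (A w) z • (B (D y) + D (B y)) - ω (B w) z • (A (D y) + D (A y))
    + (ω y (B z) • A (D w) - ω y (A (D w)) • B z)
    + (ω y (B w) • A (D z) - ω y (A (D z)) • B w)
    - (ω y (A z) • B (D w) - ω y (B (D w)) • A z)
    - (ω y (A w) • B (D z) - ω y (B (D z)) • A w)

/-- Skew endomorphisms `A, B` whose curvature expression vanishes in directions `A` and `B`. -/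
structure CurvPair (ω : LinearMap.BilinForm ℝ V) (A B : V →ₗ[ℝ] V) : Prop where
  alt : ω.IsAlt
  nondeg : ω.Nondegenerate
  skew_left : ∀ x y, ω x (A y) = -ω (A x) y
  skew_right : ∀ x y, ω x (B y) = -ω (B x) y
  eq_left : ∀ w z y, curvDefect ω A B A w z y = 0
  eq_right : ∀ w z y, curvDefect ω A B B w z y = 0

/-- Both squares and the anticommutator of `A` and `B` vanish. -/
def SquaresVanish (A B : V →ₗ[ℝ] V) : Prop :=
  (∀ x, A (A x) = 0) ∧ (∀ x, B (B x) = 0) ∧ ∀ x, A (B x) + B (A x) = 0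

theorem SquaresVanish.comb (h : SquaresVanish A B) (p q r s : ℝ) :
    SquaresVanish (p • A + q • B) (r • A + s • B) := by
  obtain ⟨h1, h2, h3⟩ := h
  refine ⟨fun x => ?_, fun x => ?_, fun x => ?_⟩ <;>
    simp only [LinearMap.add_apply, LinearMap.smul_apply, map_add, map_smul]
  · linear_combination (norm := module) (p * p) • h1 x + (q * q) • h2 x + (p * q) • h3 x
  · linear_combination (norm := module) (r * r) • h1 x + (s * s) • h2 x + (r * s) • h3 x
  · linear_combination (norm := module) (2 * p * r) • h1 x + (2 * q * s) • h2 x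
      + (p * s + q * r) • h3 x

namespace CurvPair

/-- A linear change of the pair preserves the curvature equations. -/
theorem comb (h : CurvPair ω A B) (p q r s : ℝ) :
    CurvPair ω (p • A + q • B) (r • A + s • B) where
  alt := h.alt
  nondeg := h.nondeg
  skew_left x y := by simp [h.skew_left, h.skew_right]; ring
  skew_right x y := by simp [h.skew_left, h.skew_right]; ring
  eq_left w z y := by
    have h1 := h.eq_left w z y
    have h2 := h.eq_right w z y
    simp only [curvDefect, LinearMap.add_apply, LinearMap.smul_apply, map_add, map_smul,
      smul_eq_mul] at h1 h2 ⊢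
    linear_combination (norm := module) ((p * s - q * r) * p) • h1 + ((p * s - q * r) * q) • h2
  eq_right w z y := by
    have h1 := h.eq_left w z y
    have h2 := h.eq_right w z y
    simp only [curvDefect, LinearMap.add_apply, LinearMap.smul_apply, map_add, map_smul,
      smul_eq_mul] at h1 h2 ⊢
    linear_combination (norm := module) ((p * s - q * r) * r) • h1 + ((p * s - q * r) * s) • h2

theorem swap (h : CurvPair ω A B) : CurvPair ω B A := by
  simpa using h.comb 0 1 1 0

theorem symm_left (h : CurvPair ω A B) (x y : V) : ω (A x) y = ω (A y) x := by
  rw [← h.alt.neg_eq, h.skew_left, neg_neg]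

theorem symm_right (h : CurvPair ω A B) (x y : V) : ω (B x) y = ω (B y) x :=
  h.swap.symm_left x y

theorem eq_zero (h : CurvPair ω A B) {x : V} (hx : ∀ y, ω x y = 0) : x = 0 :=
  h.nondeg.1 x hx

theorem exists_ne_zero (h : CurvPair ω A B) (hB : B ≠ 0) : ∃ w, ω (B w) w ≠ 0 := by
  by_contra! hw
  refine hB (LinearMap.ext fun x => h.eq_zero fun y => ?_)
  have h1 := hw (x + y)
  simp only [map_add, LinearMap.add_apply] at h1
  linarith [hw x, hw y, h.symm_right x y]

/-- If `B` does not vanish on the kernel of `A`, then `A` has square zero. -/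
theorem sq_eq_zero_of_ker (h : CurvPair ω A B) {w : V} (hA : A w = 0) (hB : B w ≠ 0) (x : V) :
    A (A x) = 0 := by
  obtain ⟨z, hz⟩ : ∃ z, ω (B w) z ≠ 0 := by
    by_contra! hz
    exact hB (h.eq_zero hz)
  have key : ∀ y, (2 * ω (B w) z) • A (A y) = ω y (B w) • A (A z) - ω y (A (A z)) • B w := by
    intro y
    have h1 := h.eq_left w z y
    simp only [curvDefect, hA, map_zero, LinearMap.zero_apply, zero_smul, smul_zero] at h1
    linear_combination (norm := module) -h1
  have hzz : ω z (A (A z)) = 0 := by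
    rw [h.skew_left, h.alt, neg_zero]
  have h2 : A (A z) = 0 := by
    have h1 := key z
    rw [hzz, h.skew_right, h.symm_right z w] at h1
    have h3 : (3 * ω (B w) z) • A (A z) = 0 := by linear_combination (norm := module) h1
    exact (smul_eq_zero.1 h3).resolve_left (by simpa using hz)
  have h1 := key x
  rw [h2] at h1
  simpa [hz] using h1

/-- If `B ≠ 0` has square zero, then it anticommutes with `A`. -/
theorem anticomm_of_sq_eq_zero (h : CurvPair ω A B) (hB : B ≠ 0) (hBB : ∀ x, B (B x) = 0)
    (x : V) : A (B x) + B (A x) = 0 := by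
  obtain ⟨w, hw⟩ := h.exists_ne_zero hB
  have hS : ∀ x y, ω (A (B x) + B (A x)) y = -ω (A (B y) + B (A y)) x := fun x y => by
    rw [h.alt.neg_eq]
    simp only [map_add, LinearMap.add_apply, h.skew_left, h.skew_right]
    ring
  have key : ∀ w z y, ω (B w) z • (A (B y) + B (A y)) =
      -(ω (B z) y • A (B w)) - ω (B w) y • A (B z) - ω y (A (B w)) • B z
        - ω y (A (B z)) • B w := fun w z y => by
    have h1 := h.eq_right w z y
    simp only [curvDefect, hBB, map_zero, smul_zero, h.skew_right y, h.symm_right y] at h1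
    linear_combination (norm := module) (-1 : ℝ) • h1
  have orth : ∀ z, ω (B w) z = 0 → A (B z) + B (A z) = 0 := by
    intro z hz
    have hz' : ω (B z) w = 0 := by rw [h.symm_right, hz]
    have e1 : ω (B w) w • (A (B z) + B (A z)) = (-2 * ω z (A (B w))) • B w := by
      have := key w w z
      rw [hz] at this
      linear_combination (norm := module) this
    have e2 : ω (B z) z • (A (B w) + B (A w)) = (-2 * ω w (A (B z))) • B z := by
      have := key z z w
      rw [hz'] at this
      linear_combination (norm := module) this
    have hS' : ω (A (B z) + B (A z)) w = ω z (A (B w)) - ω w (A (B z)) := by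
      rw [← h.alt.neg_eq (A (B z)) w]
      simp only [map_add, LinearMap.add_apply, h.skew_left, h.skew_right]
      ring
    have f1 := congrArg (fun v => ω v w) e1
    have f2 := congrArg (fun v => ω v z) e2
    simp only [map_smul, LinearMap.smul_apply, smul_eq_mul, hS w z, hS'] at f1 f2
    have hcd : ω w (A (B z)) = 3 * ω z (A (B w)) :=
      mul_left_cancel₀ hw (by linear_combination -f1)
    have hc : ω z (A (B w)) = 0 := by
      by_cases hb : ω (B z) z = 0
      · rw [hb, zero_smul] at e2
        rcases smul_eq_zero.1 e2.symm with h3 | h3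
        · linarith
        · rw [h3, map_zero, map_zero] at hcd
          linarith
      · have := mul_left_cancel₀ hb (f2.trans (by ring :
          _ = ω (B z) z * (-2 * ω w (A (B z)))))
        linarith
    rw [hc] at e1
    rw [mul_zero, zero_smul] at e1
    exact (smul_eq_zero.1 e1).resolve_left hw
  have hSw : A (B w) + B (A w) = 0 := by
    refine h.eq_zero fun y => ?_
    have h1 := orth (y - (ω (B w) y / ω (B w) w) • w) (by
      simp only [map_sub, map_smul, smul_eq_mul]; field_simp; ring)
    have h2 := hS w w
    have h3 := hS w (y - (ω (B w) y / ω (B w) w) • w)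
    rw [h1] at h3
    simp only [map_sub, map_smul, smul_eq_mul, map_zero, LinearMap.zero_apply] at h3
    have h4 : ω (A (B w) + B (A w)) w = 0 := by linarith
    rw [h4] at h3
    linarith
  have h1 := orth (x - (ω (B w) x / ω (B w) w) • w) (by
    simp only [map_sub, map_smul, smul_eq_mul]; field_simp; ring)
  simp only [map_sub, map_smul] at h1
  linear_combination (norm := module) h1 + (ω (B w) x / ω (B w) w) • hSw

/-- If `B` has square zero and anticommutes with `A`, then `A` has square zero. -/
theorem left_sq_eq_zero (h : CurvPair ω A B) (hB : B ≠ 0) (hBB : ∀ x, B (B x) = 0)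
    (hS : ∀ x, A (B x) + B (A x) = 0) (x : V) : A (A x) = 0 := by
  have hAB : ∀ x, A (B x) = -B (A x) := fun x => eq_neg_of_add_eq_zero_left (hS x)
  have key : ∀ z y, ω (B z) z • A (A y) =
      ω y (B z) • A (A z) - ω y (A (A z)) • B z
        - ω y (A z) • B (A z) + ω y (B (A z)) • A z := fun z y => by
    have h1 := h.eq_left z z y
    simp only [curvDefect] at h1
    rw [add_comm (B (A y)), hS] at h1
    linear_combination (norm := module) (-1 / 2 : ℝ) • h1
  have sq : ∀ z, ω z (A (A z)) = 0 := fun z => by rw [h.skew_left, h.alt, neg_zero]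
  have e1 : ∀ z, (2 * ω (B z) z) • A (A z) =
      ω (A z) z • B (A z) - ω (B (A z)) z • A z := fun z => by
    have h1 := key z z
    rw [sq, ← h.alt.neg_eq (B z) z, ← h.alt.neg_eq (A z) z, ← h.alt.neg_eq (B (A z)) z] at h1
    linear_combination (norm := module) h1
  have e2 : ∀ z, (2 * ω (B z) z) • B (A (A z)) = -(ω (B (A z)) z • B (A z)) := fun z => by
    have h1 := congrArg B (e1 z)
    simp only [map_sub, map_smul, hBB] at h1
    linear_combination (norm := module) h1
  have e3 : ∀ z, ω (B z) z • B (A (A z)) = ω (B (A (A z))) z • B z := fun z => by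
    have h1 := key z (B z)
    have c1 : ω (B z) (A (A z)) = ω (B (A (A z))) z := by
      rw [h.skew_left, h.skew_left, hAB, map_neg, hAB, neg_neg, neg_neg]
    have c2 : ω (B z) (A z) = ω (B (A z)) z := by
      rw [h.skew_left, hAB, map_neg, LinearMap.neg_apply, neg_neg]
    have c3 : ω (B z) (B (A z)) = 0 := by
      rw [h.skew_right, hBB]; simp
    rw [h.alt, c1, c2, c3, hAB, map_neg, hAB] at h1
    linear_combination (norm := module) (-1 : ℝ) • h1 + e2 z
  have hh : ∀ z, ω (B (A z)) z = 0 := fun z => by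
    have e4 : (2 * ω (B (A (A z))) z) • B z = -(ω (B (A z)) z • B (A z)) := by
      linear_combination (norm := module) e2 z - (2 : ℝ) • e3 z
    have f1 := congrArg (fun v => ω v z) e4
    have f2 := congrArg (fun v => ω v (A z)) e4
    simp only [map_neg, map_smul, LinearMap.neg_apply, LinearMap.smul_apply, smul_eq_mul,
      h.skew_left, hAB] at f1 f2
    have f3 : ω (B (A z)) z ^ 3 = 0 := by
      linear_combination ω (B (A z)) z * f1 - (2 / 3) * ω (B z) z * f2
    exact pow_eq_zero_iff (by norm_num) |>.1 f3
  have hBA : ∀ z, B (A z) = 0 := fun z => by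
    refine h.eq_zero fun y => ?_
    have h1 := hh (z + y)
    have h2 : ω (B (A y)) z = ω (B (A z)) y := by
      rw [← h.alt.neg_eq, h.skew_right, h.skew_left, hAB, map_neg, LinearMap.neg_apply]
      ring
    simp only [map_add, LinearMap.add_apply, hh, h2] at h1
    linarith
  obtain ⟨w, hw⟩ := h.exists_ne_zero hB
  have h1 := e1 w
  rw [hBA] at h1
  have h2 : A (A w) = 0 := by simpa [hw] using h1
  have h3 := key w x
  rw [h2, hBA] at h3
  simpa [hw] using h3

theorem squaresVanish_of_sq_eq_zero (h : CurvPair ω A B) (hB : B ≠ 0)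
    (hBB : ∀ x, B (B x) = 0) : SquaresVanish A B :=
  have hS := h.anticomm_of_sq_eq_zero hB hBB
  ⟨h.left_sq_eq_zero hB hBB hS, hBB, hS⟩

/-- Two vectors that form an eigenvector `u + i v` of the complexified pencil. -/
theorem anticomm_of_complex_ker (h : CurvPair ω A B) {u v : V} (hA : A v = B u)
    (hB : B v = -A u) (hu : A u ≠ 0) (x : V) :
    A (B x) + B (A x) = 0 ∧ A (A x) = B (B x) := by
  obtain ⟨z, hz⟩ : ∃ z, ω (A u) z ≠ 0 := by
    by_contra! hz
    exact hu (h.eq_zero hz)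
  set n := ω (B u) z ^ 2 + ω (A u) z ^ 2 with hn
  have hn0 : n ≠ 0 := by positivity
  have k1 : ∀ y, (2 * ω (B u) z) • (A (A y) - B (B y)) -
      (2 * ω (A u) z) • (A (B y) + B (A y)) =
      ω y (B u) • (A (A z) - B (B z)) - ω y (A (A z) - B (B z)) • B u
      - ω y (A u) • (A (B z) + B (A z)) + ω y (A (B z) + B (A z)) • A u := fun y => by
    have h1 := h.eq_left u z y
    have h2 := h.eq_right v z y
    simp only [curvDefect, hA, hB, map_neg, LinearMap.neg_apply] at h1 h2
    simp only [map_add, map_sub]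
    linear_combination (norm := module) (-1 : ℝ) • h1 - h2
  have k2 : ∀ y, (2 * ω (B u) z) • (A (B y) + B (A y)) +
      (2 * ω (A u) z) • (A (A y) - B (B y)) =
      ω y (B u) • (A (B z) + B (A z)) - ω y (A (B z) + B (A z)) • B u
      + ω y (A u) • (A (A z) - B (B z)) - ω y (A (A z) - B (B z)) • A u := fun y => by
    have h1 := h.eq_left v z y
    have h2 := h.eq_right u z y
    simp only [curvDefect, hA, hB, map_neg, LinearMap.neg_apply] at h1 h2
    simp only [map_add, map_sub]
    linear_combination (norm := module) h1 - h2
  have sA : ω z (A (A z)) = 0 := by rw [h.skew_left, h.alt, neg_zero]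
  have sB : ω z (B (B z)) = 0 := by rw [h.skew_right, h.alt, neg_zero]
  have sS : ω z (A (B z) + B (A z)) = 0 := by
    rw [map_add, h.skew_left, h.skew_right, ← h.alt.neg_eq]; ring
  have sX : ω z (A (A z) - B (B z)) = 0 := by rw [map_sub, sA, sB, sub_zero]
  have c1 := k1 z
  have c2 := k2 z
  rw [sX, sS, ← h.alt.neg_eq (B u) z, ← h.alt.neg_eq (A u) z] at c1 c2
  have hX : A (A z) - B (B z) = 0 := (smul_eq_zero.1 (show n • _ = (0 : V) by
    linear_combination (norm := module) (ω (B u) z / 3) • c1 + (ω (A u) z / 3) • c2)).resolve_left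
      hn0
  have hS : A (B z) + B (A z) = 0 := (smul_eq_zero.1 (show n • _ = (0 : V) by
    linear_combination (norm := module) (ω (B u) z / 3) • c2 - (ω (A u) z / 3) • c1)).resolve_left
      hn0
  have d1 := k1 x
  have d2 := k2 x
  simp only [hX, hS, map_zero, zero_smul, smul_zero, sub_zero, add_zero] at d1 d2
  refine ⟨(smul_eq_zero.1 (show n • _ = (0 : V) by
    linear_combination (norm := module) (ω (B u) z / 2) • d2 - (ω (A u) z / 2) • d1)).resolve_left
      hn0, sub_eq_zero.1 <| (smul_eq_zero.1 (show n • _ = (0 : V) by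
    linear_combination (norm := module) (ω (B u) z / 2) • d1 + (ω (A u) z / 2) • d2)).resolve_left
      hn0⟩

/-- The case of an anticommuting pair with equal squares. -/
theorem squaresVanish_of_sq_eq_sq (h : CurvPair ω A B) (hB : B ≠ 0)
    (hS : ∀ x, A (B x) + B (A x) = 0) (hJ : ∀ x, B (B x) = A (A x)) : SquaresVanish A B := by
  have hAB : ∀ x, A (B x) = -B (A x) := fun x => eq_neg_of_add_eq_zero_left (hS x)
  obtain ⟨w, hw⟩ := h.exists_ne_zero hB
  have k1 : ∀ y, ω (B w) w • A (A y) =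
      ω y (B w) • A (A w) - ω y (A (A w)) • B w
        - ω y (A w) • B (A w) + ω y (B (A w)) • A w := fun y => by
    have h1 := h.eq_left w w y
    simp only [curvDefect, hAB] at h1
    linear_combination (norm := module) (-1 / 2 : ℝ) • h1
  have k2 : ∀ y, ω (A w) w • A (A y) =
      ω y (A w) • A (A w) - ω y (A (A w)) • A w
        + ω y (B w) • B (A w) - ω y (B (A w)) • B w := fun y => by
    have h1 := h.eq_right w w y
    simp only [curvDefect, hAB, hJ, map_neg] at h1
    linear_combination (norm := module) (1 / 2 : ℝ) • h1
  have sq : ω w (A (A w)) = 0 := by rw [h.skew_left, h.alt, neg_zero]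
  have e1 := k1 w
  have e2 := k2 w
  rw [sq, ← h.alt.neg_eq (A w) w, ← h.alt.neg_eq (B w) w, ← h.alt.neg_eq (B (A w)) w] at e1 e2
  set a := ω (A w) w
  set b := ω (B w) w
  set c := ω (B (A w)) w
  have hn : a ^ 2 + b ^ 2 ≠ 0 := by positivity
  have f1 : (2 * (a ^ 2 + b ^ 2)) • A (A w) = (c * a) • B w - (c * b) • A w := by
    linear_combination (norm := module) b • e1 + a • e2
  have f2 : (a ^ 2 + b ^ 2) • B (A w) = (c * a) • A w + (c * b) • B w := by
    linear_combination (norm := module) b • e2 - a • e1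
  have g1 := congrArg A f1
  have g2 := congrArg B f1
  have g3 := congrArg A f2
  have g4 := congrArg B f2
  simp only [map_add, map_sub, map_smul, hJ, hAB] at g1 g2 g3 g4
  have m1 : c • A (A w) = 0 := (smul_eq_zero.1 (show (a ^ 2 + b ^ 2) • _ = (0 : V) by
    linear_combination (norm := module) (b / 3) • (g1 - (2 : ℝ) • g4) - (a / 3) • (g2 + (2 : ℝ) • g3))).resolve_left hn
  have m2 : c • B (A w) = 0 := (smul_eq_zero.1 (show (a ^ 2 + b ^ 2) • _ = (0 : V) by
    linear_combination (norm := module) (a / 3) • (g1 - (2 : ℝ) • g4) + (b / 3) • (g2 + (2 : ℝ) • g3))).resolve_left hn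
  have hBw : B w ≠ 0 := fun h0 => hw (by simp [b, h0])
  have hc : c = 0 := by
    have : (c ^ 2 * (a ^ 2 + b ^ 2)) • B w = 0 := by
      linear_combination (norm := module) (-a * c) • f1 + (a ^ 2 + b ^ 2) • ((2 * a) • m1 + b • m2)
        - (b * c) • f2
    simpa [hn, hBw] using this
  rw [hc] at f1 f2
  have j0 : A (A w) = 0 := by simpa [hn] using f1
  have j1 : B (A w) = 0 := by simpa [hn] using f2
  have hA : ∀ x, A (A x) = 0 := fun x => by
    have := k1 x
    rw [j0, j1] at this
    simpa [hw] using this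
  exact ⟨hA, fun x => by rw [hJ, hA], hS⟩

/-- Some nonzero element of the pencil kills a vector outside the common kernel. -/
theorem squaresVanish_of_real_ker (h : CurvPair ω A B) (hli : LinearIndependent ℝ ![A, B])
    {u : V} {p q : ℝ} (hpq : p ≠ 0 ∨ q ≠ 0) (hu : p • A u + q • B u = 0)
    (hAB : A u ≠ 0 ∨ B u ≠ 0) : SquaresVanish A B := by
  have hne : ∀ r s : ℝ, r ≠ 0 ∨ s ≠ 0 → r • A + s • B ≠ 0 := fun r s hrs h0 => by
    have := LinearIndependent.pair_iff.1 hli r s h0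
    tauto
  have hpos : p ^ 2 + q ^ 2 ≠ 0 := by
    rcases hpq with h0 | h0 <;> positivity
  have h' := h.comb (-q) p p q
  have hk : (-q • A + p • B) u ≠ 0 := fun h0 => by
    simp only [LinearMap.add_apply, LinearMap.smul_apply] at h0
    have hA : (p ^ 2 + q ^ 2) • A u = 0 := by
      linear_combination (norm := module) p • hu - q • h0
    have hB : (p ^ 2 + q ^ 2) • B u = 0 := by
      linear_combination (norm := module) q • hu + p • h0
    simp only [smul_eq_zero, hpos, false_or] at hA hB
    tauto
  have hsq := h'.swap.sq_eq_zero_of_ker (by simpa using hu) hk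
  have := (h'.squaresVanish_of_sq_eq_zero (hne p q hpq) hsq).comb
    (-q / (p ^ 2 + q ^ 2)) (p / (p ^ 2 + q ^ 2)) (p / (p ^ 2 + q ^ 2)) (q / (p ^ 2 + q ^ 2))
  convert this using 1 <;>
    (ext x; simp only [LinearMap.add_apply, LinearMap.smul_apply]; match_scalars <;>
      field_simp <;> ring)

/-- Both squares and the anticommutator vanish for a linearly independent pair. -/
theorem squaresVanish [FiniteDimensional ℝ V] (h : CurvPair ω A B)
    (hli : LinearIndependent ℝ ![A, B]) : SquaresVanish A B := by
  have hA0 : A ≠ 0 := hli.ne_zero 0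
  by_cases hker : LinearMap.ker A ≤ LinearMap.ker B
  swap
  · obtain ⟨u, hu, hu'⟩ := SetLike.not_le_iff_exists.1 hker
    rw [LinearMap.mem_ker] at hu hu'
    exact h.squaresVanish_of_real_ker hli (p := 1) (q := 0) (by simp) (by simpa using hu)
      (Or.inr hu')
  obtain ⟨T, hT⟩ : ∃ T : V →ₗ[ℝ] V, ∀ x, A (T x) = B x := by
    obtain ⟨T', hT'⟩ := LinearMap.exists_extend
      ((LinearMap.ker A).liftQ B hker ∘ₗ A.quotKerEquivRange.symm.toLinearMap)
    have hT2 : ∀ x, T' (A x) = B x := fun x => by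
      have := LinearMap.congr_fun hT' ⟨A x, x, rfl⟩
      have e : A.quotKerEquivRange.symm ⟨A x, x, rfl⟩ = (LinearMap.ker A).mkQ x :=
        A.quotKerEquivRange_symm_apply_image x _
      simpa [e] using this
    refine ⟨ω.leftAdjointOfNondegenerate h.nondeg T', fun x => sub_eq_zero.1 <|
      h.eq_zero fun y => ?_⟩
    have := LinearMap.BilinForm.isAdjointPairLeftAdjointOfNondegenerate ω h.nondeg T' x (A y)
    rw [hT2, h.skew_right, h.skew_left] at this
    simp only [map_sub, LinearMap.sub_apply]
    linarith
  obtain ⟨v, hv⟩ : ∃ v, A v ≠ 0 := by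
    by_contra! h0
    exact hA0 (LinearMap.ext h0)
  open Polynomial in
  obtain ⟨q, hq, u, hu, hqu⟩ : ∃ q : ℝ[X], Irreducible q ∧ ∃ u, A u ≠ 0 ∧
      A (aeval T q u) = 0 := by
    have hp : ∀ p : ℝ[X], p ≠ 0 → ∀ v, A v ≠ 0 → A (aeval T p v) = 0 →
        ∃ q : ℝ[X], Irreducible q ∧ ∃ u, A u ≠ 0 ∧ A (aeval T q u) = 0 := by
      intro p
      induction p using WfDvdMonoid.induction_on_irreducible with
      | zero => exact fun h0 => absurd rfl h0
      | unit p hp =>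
        intro _ v hv h0
        obtain ⟨r, hr, rfl⟩ := Polynomial.isUnit_iff.1 hp
        simp [aeval_C, Module.algebraMap_end_apply, hr.ne_zero, hv] at h0
      | mul p i hp hi ih =>
        intro _ v hv h0
        by_cases h1 : A (aeval T p v) = 0
        · exact ih hp v hv h1
        · exact ⟨i, hi, _, h1, by simpa using h0⟩
    exact hp (minpoly ℝ T) (minpoly.ne_zero (Algebra.IsIntegral.isIntegral T)) v hv (by simp)
  have hq2 := Polynomial.eq_quadratic_of_degree_le_two hq.degree_le_two
  set e₀ := q.coeff 0
  set e₁ := q.coeff 1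
  set e₂ := q.coeff 2
  have hrel : e₂ • B (T u) + e₁ • B u + e₀ • A u = 0 := by
    rw [hq2] at hqu
    simpa [pow_two, Module.algebraMap_end_apply, hT] using hqu
  by_cases he₂ : e₂ = 0
  · refine h.squaresVanish_of_real_ker hli (u := u) (p := e₀) (q := e₁) ?_ ?_ (Or.inl hu)
    · by_contra! h0
      exact hq.ne_zero (by rw [hq2, he₂, h0.1, h0.2]; simp)
    · rw [he₂] at hrel
      linear_combination (norm := module) hrel
  have hdisc : e₁ ^ 2 - 4 * e₂ * e₀ < 0 := by
    by_contra! h0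
    obtain ⟨r, hr⟩ := exists_quadratic_eq_zero he₂
      ⟨√(discrim e₂ e₁ e₀), (Real.mul_self_sqrt h0).symm⟩
    have h1 := Polynomial.degree_eq_one_of_irreducible_of_root hq (x := r) (by
      rw [hq2]
      simp only [Polynomial.IsRoot, Polynomial.eval_add, Polynomial.eval_mul, Polynomial.eval_C,
        Polynomial.eval_pow, Polynomial.eval_X]
      linear_combination hr)
    rw [hq2, Polynomial.degree_quadratic he₂] at h1
    exact absurd h1 (by decide)
  set c := e₁ / (2 * e₂) with hc
  have hd : 0 < e₀ / e₂ - c ^ 2 := by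
    have : e₀ / e₂ - c ^ 2 = -(e₁ ^ 2 - 4 * e₂ * e₀) / (4 * e₂ ^ 2) := by
      rw [hc]; field_simp; ring
    rw [this]
    have : 0 < -(e₁ ^ 2 - 4 * e₂ * e₀) := by linarith
    positivity
  set β := √(e₀ / e₂ - c ^ 2)
  have hβ : 0 < β := Real.sqrt_pos.2 hd
  have hββ : β * β = e₀ / e₂ - c ^ 2 := Real.mul_self_sqrt hd.le
  have hBT : B (T u) = -(2 * c) • B u - (β * β + c ^ 2) • A u := by
    have h1 : B (T u) = -(e₁ / e₂) • B u - (e₀ / e₂) • A u := by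
      have h2 := congrArg (fun v => e₂⁻¹ • v) hrel
      simp only [smul_add, smul_smul, inv_mul_cancel₀ he₂, smul_zero, one_smul] at h2
      linear_combination (norm := module) h2
    rw [h1, hββ, hc]
    match_scalars <;> field_simp
    ring
  have h' := h.comb β 0 c 1
  have hc' := h'.anticomm_of_complex_ker (u := u) (v := β⁻¹ • (T u + c • u))
    (by
      simp only [LinearMap.add_apply, LinearMap.smul_apply, map_add, map_smul, hT]
      match_scalars <;> field_simp <;> ring)
    (by
      simp only [LinearMap.add_apply, LinearMap.smul_apply, map_add, map_smul, hT, hBT]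
      match_scalars <;> field_simp <;> ring)
    (by simp [hβ.ne', hu])
  have hB' : c • A + (1 : ℝ) • B ≠ 0 := fun h0 =>
    one_ne_zero (LinearIndependent.pair_iff.1 hli _ _ h0).2
  have := (h'.squaresVanish_of_sq_eq_sq hB' (fun x => (hc' x).1) fun x => (hc' x).2.symm).comb
    β⁻¹ 0 (-(c * β⁻¹)) 1
  convert this using 1 <;>
    (ext x; simp only [LinearMap.add_apply, LinearMap.smul_apply]; match_scalars <;>
      field_simp <;> ring)

end CurvPair

end

/-- If linearly independent `ω`-skew `C₁, C₂` satisfy the curvature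
equations (Ea), (Eb), then `C∘C = 0` for every `C` in the span of `{C₁, C₂}`;
in particular `C₁∘C₁ = C₂∘C₂ = 0` and `C₁∘C₂ + C₂∘C₁ = 0`. -/
theorem squares_vanish_on_span
    (V : Type*) [AddCommGroup V] [Module ℝ V] [FiniteDimensional ℝ V]
    (ω : LinearMap.BilinForm ℝ V) (hAlt : ω.IsAlt) (hNd : ω.Nondegenerate)
    (C₁ C₂ : V →ₗ[ℝ] V)
    (h₁ : ∀ x y, ω (C₁ x) y + ω x (C₁ y) = 0)
    (h₂ : ∀ x y, ω (C₂ x) y + ω x (C₂ y) = 0)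
    (hli : LinearIndependent ℝ ![C₁, C₂])
    (hEa : ∀ x y : V,
      rond ω (C₁ (C₁ x)) (C₂ y) - rond ω (C₁ (C₂ x)) (C₁ y)
        - rond ω (C₁ (C₁ y)) (C₂ x) + rond ω (C₁ (C₂ y)) (C₁ x)
        + ω ((C₁ ∘ₗ C₂ + C₂ ∘ₗ C₁) y) x • C₁ - (2 * ω (C₁ (C₁ y)) x) • C₂ = 0)
    (hEb : ∀ x y : V,
      rond ω (C₂ (C₁ x)) (C₂ y) - rond ω (C₂ (C₂ x)) (C₁ y)
        - rond ω (C₂ (C₁ y)) (C₂ x) + rond ω (C₂ (C₂ y)) (C₁ x)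
        + (2 * ω (C₂ (C₂ y)) x) • C₁ - ω ((C₂ ∘ₗ C₁ + C₁ ∘ₗ C₂) y) x • C₂ = 0) :
    (∀ C ∈ Submodule.span ℝ ({C₁, C₂} : Set (V →ₗ[ℝ] V)), C ∘ₗ C = 0) ∧
      C₁ ∘ₗ C₁ = 0 ∧ C₂ ∘ₗ C₂ = 0 ∧ C₁ ∘ₗ C₂ + C₂ ∘ₗ C₁ = 0 := by
  have hs₁ : ∀ x y, ω x (C₁ y) = -ω (C₁ x) y := fun x y => by linarith [h₁ x y]
  have hs₂ : ∀ x y, ω x (C₂ y) = -ω (C₂ x) y := fun x y => by linarith [h₂ x y]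
  have h : CurvPair ω C₁ C₂ := by
    have sym₁ : ∀ u v, ω (C₁ u) v = ω (C₁ v) u := fun u v => by
      rw [← hAlt.neg_eq, hs₁, neg_neg]
    have sym₂ : ∀ u v, ω (C₂ u) v = ω (C₂ v) u := fun u v => by
      rw [← hAlt.neg_eq, hs₂, neg_neg]
    have sym₁₂ : ∀ u v, ω (C₁ (C₂ u)) v = -ω (C₂ (C₁ v)) u := fun u v => by
      rw [sym₁, hs₂]
    have sym₂₁ : ∀ u v, ω (C₂ (C₁ u)) v = -ω (C₁ (C₂ v)) u := fun u v => by
      rw [sym₂, hs₁]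
    have sym₁₁ : ∀ u v, ω (C₁ (C₁ u)) v = -ω (C₁ (C₁ v)) u := fun u v => by
      rw [sym₁, hs₁]
    have sym₂₂ : ∀ u v, ω (C₂ (C₂ u)) v = -ω (C₂ (C₂ v)) u := fun u v => by
      rw [sym₂, hs₂]
    refine ⟨hAlt, hNd, hs₁, hs₂, fun w z y => hNd.1 _ fun x => ?_, fun w z y => hNd.1 _ fun x => ?_⟩
    · have := congrArg (fun f : V →ₗ[ℝ] V => ω (f w) z) (hEa x y)
      simp only [rond, LinearMap.add_apply, LinearMap.sub_apply, LinearMap.smul_apply,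
        LinearMap.smulRight_apply, LinearMap.comp_apply, map_add, map_sub, map_smul, smul_eq_mul,
        LinearMap.zero_apply, map_zero] at this
      simp only [curvDefect, LinearMap.add_apply, LinearMap.sub_apply, LinearMap.smul_apply,
        map_add, map_sub, map_smul, smul_eq_mul, hs₁, hs₂]
      rw [sym₁ w x, sym₁ z x, sym₂ w x, sym₂ z x, sym₁₁ w x, sym₁₁ z x, sym₂₁ w x, sym₂₁ z x]
      linear_combination this
    · have := congrArg (fun f : V →ₗ[ℝ] V => ω (f w) z) (hEb x y)
      simp only [rond, LinearMap.add_apply, LinearMap.sub_apply, LinearMap.smul_apply,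
        LinearMap.smulRight_apply, LinearMap.comp_apply, map_add, map_sub, map_smul, smul_eq_mul,
        LinearMap.zero_apply, map_zero] at this
      simp only [curvDefect, LinearMap.add_apply, LinearMap.sub_apply, LinearMap.smul_apply,
        map_add, map_sub, map_smul, smul_eq_mul, hs₁, hs₂]
      rw [sym₁ w x, sym₁ z x, sym₂ w x, sym₂ z x, sym₁₂ w x, sym₁₂ z x, sym₂₂ w x, sym₂₂ z x]
      linear_combination this
  have hv := h.squaresVanish hli
  refine ⟨fun C hC => ?_, LinearMap.ext hv.1, LinearMap.ext hv.2.1, LinearMap.ext hv.2.2⟩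
  obtain ⟨p, q, rfl⟩ := Submodule.mem_span_pair.1 hC
  exact LinearMap.ext (hv.comb p q 0 0).1
end

section
/- Let (V, ω) be a finite-dimensional real symplectic vector space and let C₁, C₂ be linearly independent ω-skew endomorphisms of V, each of rank one. Then there exist real numbers a, b such that the endomorphism a·C₁ + b·C₂ has rank at least 2. In other words, a two-dimensional subspace of sp(V,ω) cannot consist entirely of endomorphisms of rank at most one. -/
/-- A rank-one endomorphism that is skew for a left-separating alternating form `ω` is a nonzero
multiple of `x ↦ ω u x • u` for some `u ≠ 0`. -/
theorem exists_eq_smul_of_skew_of_finrank_range_eq_one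
    {K V : Type*} [Field K] [AddCommGroup V] [Module K V]
    {ω : LinearMap.BilinForm K V} (hAlt : ω.IsAlt) (hsep : ∀ u, (∀ x, ω u x = 0) → u = 0)
    {C : V →ₗ[K] V} (hC : ∀ x y, ω (C x) y + ω x (C y) = 0)
    (hr : Module.finrank K (LinearMap.range C) = 1) :
    ∃ (u : V) (c : K), u ≠ 0 ∧ c ≠ 0 ∧ ∀ x, C x = (c * ω u x) • u := by
  obtain ⟨⟨u, z, hz⟩, hu, hspan⟩ := finrank_eq_one_iff'.mp hr
  have hu0 : u ≠ 0 := fun h => hu (Subtype.ext h)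
  have hf : ∀ x, ∃ t : K, C x = t • u := fun x => by
    obtain ⟨t, ht⟩ := hspan ⟨C x, x, rfl⟩
    exact ⟨t, (congrArg Subtype.val ht).symm⟩
  choose f hf using hf
  have hsymm : ∀ x y, f x * ω u y = f y * ω u x := fun x y => by
    have h := hC x y
    rw [hf x, hf y, map_smul, map_smul, LinearMap.smul_apply, smul_eq_mul, smul_eq_mul,
      ← hAlt.neg_eq u x] at h
    linear_combination h
  obtain ⟨y, hy⟩ : ∃ y, ω u y ≠ 0 := by
    by_contra! h
    exact hu0 (hsep u h)
  have key : ∀ x, C x = (f y / ω u y * ω u x) • u := fun x => by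
    rw [hf x, div_mul_eq_mul_div, ← hsymm x y, mul_div_cancel_right₀ _ hy]
  refine ⟨u, f y / ω u y, hu0, fun hc => hu0 ?_, key⟩
  rw [← hz, key z, hc, zero_mul, zero_smul]

/-- If `u` is not a multiple of `v ≠ 0`, a left-separating form has a vector pairing to zero with
`v` but not with `u`. -/
theorem exists_apply_eq_zero_and_apply_ne_zero
    {K V : Type*} [Field K] [AddCommGroup V] [Module K V]
    {ω : LinearMap.BilinForm K V} (hsep : ∀ u, (∀ x, ω u x = 0) → u = 0)
    {u v : V} (hv : v ≠ 0) (huv : ∀ k : K, u ≠ k • v) :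
    ∃ x, ω v x = 0 ∧ ω u x ≠ 0 := by
  by_contra! h
  obtain ⟨y, hy⟩ : ∃ y, ω v y ≠ 0 := by
    by_contra! h'
    exact hv (hsep v h')
  refine huv (ω u y / ω v y) (sub_eq_zero.mp (hsep _ fun x => ?_))
  have hx := h (ω v y • x - ω v x • y) (by simp [mul_comm])
  simp only [map_sub, map_smul, smul_eq_mul, LinearMap.sub_apply, LinearMap.smul_apply] at hx ⊢
  field_simp
  linear_combination hx


/-- A two-dimensional subspace of `sp(V,ω)` cannot consist entirely of
endomorphisms of rank at most one: if `C₁, C₂` are linearly independent `ω`-skew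
endomorphisms of rank one, then some combination `a·C₁ + b·C₂` has rank at least `2`. -/
theorem exists_combination_rank_ge_two
    (V : Type*) [AddCommGroup V] [Module ℝ V] [FiniteDimensional ℝ V]
    (ω : LinearMap.BilinForm ℝ V) (hAlt : ω.IsAlt) (hNd : ω.Nondegenerate)
    (C₁ C₂ : V →ₗ[ℝ] V)
    (h₁ : ∀ x y, ω (C₁ x) y + ω x (C₁ y) = 0)
    (h₂ : ∀ x y, ω (C₂ x) y + ω x (C₂ y) = 0)
    (hli : LinearIndependent ℝ ![C₁, C₂])
    (hr₁ : Module.finrank ℝ (LinearMap.range C₁) = 1)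
    (hr₂ : Module.finrank ℝ (LinearMap.range C₂) = 1) :
    ∃ a b : ℝ, 2 ≤ Module.finrank ℝ (LinearMap.range (a • C₁ + b • C₂)) := by
  have hsep : ∀ u, (∀ x, ω u x = 0) → u = 0 := hNd.1
  obtain ⟨u, c, hu, hc, hC₁⟩ := exists_eq_smul_of_skew_of_finrank_range_eq_one hAlt hsep h₁ hr₁
  obtain ⟨v, d, hv, hd, hC₂⟩ := exists_eq_smul_of_skew_of_finrank_range_eq_one hAlt hsep h₂ hr₂
  have huv : ∀ k : ℝ, u ≠ k • v := by
    rintro k rfl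
    have h := LinearIndependent.pair_iff.mp hli d (-(c * k ^ 2)) (by
      ext x
      simp only [LinearMap.add_apply, LinearMap.smul_apply, hC₁, hC₂, map_smul, smul_eq_mul,
        LinearMap.zero_apply]
      module)
    exact hd h.1
  have hvu : ∀ k : ℝ, v ≠ k • u := by
    rintro k rfl
    have hk : k ≠ 0 := fun hk => hv (by rw [hk, zero_smul])
    exact huv k⁻¹ (by rw [inv_smul_smul₀ hk])
  obtain ⟨x, hvx, hux⟩ := exists_apply_eq_zero_and_apply_ne_zero hsep hv huv
  obtain ⟨y, huy, hvy⟩ := exists_apply_eq_zero_and_apply_ne_zero hsep hu hvu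
  have hind : LinearIndependent ℝ ![u, v] :=
    (LinearIndependent.pair_iff' hu).mpr fun k hk => hvu k hk.symm
  refine ⟨1, 1, ?_⟩
  have hmem : Submodule.span ℝ (Set.range ![u, v]) ≤
      LinearMap.range ((1 : ℝ) • C₁ + (1 : ℝ) • C₂) := by
    rw [Submodule.span_le]
    rintro _ ⟨i, rfl⟩
    fin_cases i
    · refine ⟨(c * ω u x)⁻¹ • x, ?_⟩
      simp [hC₁, hC₂, hvx, -mul_inv_rev, inv_smul_smul₀ (mul_ne_zero hc hux)]
    · refine ⟨(d * ω v y)⁻¹ • y, ?_⟩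
      simp [hC₁, hC₂, huy, -mul_inv_rev, inv_smul_smul₀ (mul_ne_zero hd hvy)]
  simpa [finrank_span_eq_card hind] using Submodule.finrank_mono hmem
end

section
/- Let (V, ω) be a finite-dimensional real symplectic vector space and let A, B be ω-skew endomorphisms of V. Define the quadrilinear form φ_{A,B}(X,Y,Z,T) := ω(BY,Z)ω(AX,T) − ω(AY,Z)ω(BX,T) − ω(BX,Z)ω(AY,T) + ω(AX,Z)ω(BY,T). Then φ_{A,B} is an algebraic symplectic curvature tensor: it is antisymmetric under the exchange of X and Y, symmetric under the exchange of Z and T, and satisfies the first Bianchi identity φ_{A,B}(X,Y,Z,T) + φ_{A,B}(Y,Z,X,T) + φ_{A,B}(Z,X,Y,T) = 0 for all X, Y, Z, T ∈ V. -/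
/-- The quadrilinear form `φ_{A,B}` associated to two endomorphisms of a symplectic vector
space. -/
def phiAB {V : Type*} [AddCommGroup V] [Module ℝ V]
    (ω : LinearMap.BilinForm ℝ V) (A B : V →ₗ[ℝ] V) (X Y Z T : V) : ℝ :=
  ω (B Y) Z * ω (A X) T - ω (A Y) Z * ω (B X) T
    - ω (B X) Z * ω (A Y) T + ω (A X) Z * ω (B Y) T

/-- For `ω`-skew `A, B`, the form `φ_{A,B}` is an algebraic symplectic
curvature tensor: antisymmetric in `X, Y`, symmetric in `Z, T`, and satisfying the first
Bianchi identity. -/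
theorem phiAB_is_curvature_tensor
    (V : Type*) [AddCommGroup V] [Module ℝ V] [FiniteDimensional ℝ V]
    (ω : LinearMap.BilinForm ℝ V) (hAlt : ω.IsAlt) (hNd : ω.Nondegenerate)
    (A B : V →ₗ[ℝ] V)
    (hA : ∀ x y, ω (A x) y + ω x (A y) = 0)
    (hB : ∀ x y, ω (B x) y + ω x (B y) = 0) :
    (∀ X Y Z T : V, phiAB ω A B Y X Z T = - phiAB ω A B X Y Z T) ∧
    (∀ X Y Z T : V, phiAB ω A B X Y T Z = phiAB ω A B X Y Z T) ∧
    (∀ X Y Z T : V,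
      phiAB ω A B X Y Z T + phiAB ω A B Y Z X T + phiAB ω A B Z X Y T = 0) := by
  have symm_of_skew (C : V →ₗ[ℝ] V) (hC : ∀ x y, ω (C x) y + ω x (C y) = 0) (x y : V) :
      ω (C x) y = ω (C y) x := by
    linarith [hC x y, LinearMap.IsAlt.neg hAlt x (C y)]
  refine ⟨fun X Y Z T => ?_, fun X Y Z T => ?_, fun X Y Z T => ?_⟩
  · unfold phiAB
    ring
  · unfold phiAB
    ring
  · unfold phiAB
    rw [symm_of_skew A hA Z X, symm_of_skew A hA Z Y, symm_of_skew A hA Y X,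
      symm_of_skew B hB Z X, symm_of_skew B hB Z Y, symm_of_skew B hB Y X]
    ring
end

section
/- Let (V, ω) be a finite-dimensional real symplectic vector space and let A, B be ω-skew endomorphisms of V. For fixed X, Y ∈ V, consider the endomorphism of V given by Z ↦ ω(BZ,Y)·AX − ω(AZ,Y)·BX − ω(BX,Y)·AZ + ω(AX,Y)·BZ (this is Z ↦ R(X,Z)Y for the curvature tensor R associated to A∧B). Its trace equals −ω([A,B]X, Y), where [A,B] = A∘B − B∘A. That is, the Ricci tensor of the algebraic curvature tensor φ_{A,B} is ric(X,Y) = −ω([A,B]X,Y). -/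
/-- An endomorphism that is skew for a nondegenerate bilinear form has trace zero. -/
theorem LinearMap.BilinForm.trace_eq_zero_of_skew
    {V : Type*} [AddCommGroup V] [Module ℝ V] [FiniteDimensional ℝ V]
    {ω : LinearMap.BilinForm ℝ V} (hNd : ω.Nondegenerate) {A : V →ₗ[ℝ] V}
    (hA : ∀ x y, ω (A x) y + ω x (A y) = 0) :
    LinearMap.trace ℝ V A = 0 := by
  have hconj : (ω.toDual hNd).conj (-A) = Module.Dual.transpose (R := ℝ) A := by
    ext f y
    obtain ⟨x, rfl⟩ := (ω.toDual hNd).surjective f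
    simpa [LinearEquiv.conj_apply, LinearMap.BilinForm.toDual_def, Module.Dual.transpose_apply]
      using neg_eq_of_add_eq_zero_right (hA x y)
  have htr := LinearMap.trace_conj' (-A) (ω.toDual hNd)
  rw [hconj, LinearMap.trace_transpose', map_neg] at htr
  linarith

/-- For `ω`-skew `A, B` and fixed `X, Y`, the trace of the endomorphism
`Z ↦ ω(BZ,Y)·AX − ω(AZ,Y)·BX − ω(BX,Y)·AZ + ω(AX,Y)·BZ` equals `−ω([A,B]X, Y)`:
the Ricci tensor of `φ_{A,B}` is `ric(X,Y) = −ω([A,B]X,Y)`. -/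
theorem ricci_of_phiAB
    (V : Type*) [AddCommGroup V] [Module ℝ V] [FiniteDimensional ℝ V]
    (ω : LinearMap.BilinForm ℝ V) (hAlt : ω.IsAlt) (hNd : ω.Nondegenerate)
    (A B : V →ₗ[ℝ] V)
    (hA : ∀ x y, ω (A x) y + ω x (A y) = 0)
    (hB : ∀ x y, ω (B x) y + ω x (B y) = 0)
    (X Y : V) :
    LinearMap.trace ℝ V
        ((ω.flip Y ∘ₗ B).smulRight (A X) - (ω.flip Y ∘ₗ A).smulRight (B X)
          - ω (B X) Y • A + ω (A X) Y • B) =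
      - ω ((A ∘ₗ B - B ∘ₗ A) X) Y := by
  have hA0 := LinearMap.BilinForm.trace_eq_zero_of_skew hNd hA
  have hB0 := LinearMap.BilinForm.trace_eq_zero_of_skew hNd hB
  simp [LinearMap.trace_smulRight, hA0, hB0]
end

section
/- Let (V, ω) be a finite-dimensional real symplectic vector space. Let R be any quadrilinear form on V which is antisymmetric in its first two arguments, symmetric in its last two arguments, and satisfies the first Bianchi identity R(X,Y,Z,T) + R(Y,Z,X,T) + R(Z,X,Y,T) = 0 for all X,Y,Z,T ∈ V. Then there exist finitely many pairs (A₁,B₁), …, (A_r,B_r) of ω-skew endomorphisms of V such that R = Σᵢ φ_{Aᵢ,Bᵢ}, where φ_{A,B}(X,Y,Z,T) := ω(BY,Z)ω(AX,T) − ω(AY,Z)ω(BX,T) − ω(BX,Z)ω(AY,T) + ω(AX,Z)ω(BY,T). (Surjectivity of the map φ from Λ²sp(V,ω) onto the space of algebraic symplectic curvature tensors.) -/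
/-- Every symmetric product of two linear forms is represented through a nondegenerate alternating
form by a skew endomorphism. -/
lemma exists_skew_eq_symm_mul {V : Type*} [AddCommGroup V] [Module ℝ V] [FiniteDimensional ℝ V]
    {ω : LinearMap.BilinForm ℝ V} (hAlt : ω.IsAlt) (hNd : ω.Nondegenerate)
    (f g : Module.Dual ℝ V) :
    ∃ A : V →ₗ[ℝ] V, (∀ x y, ω (A x) y + ω x (A y) = 0) ∧
      ∀ x y, ω (A x) y = f x * g y + g x * f y := by
  obtain ⟨u, hu⟩ := (ω.toDual hNd).surjective f
  obtain ⟨v, hv⟩ := (ω.toDual hNd).surjective g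
  have hu' (y : V) : ω u y = f y := by rw [← hu, LinearMap.BilinForm.toDual_def]
  have hv' (y : V) : ω v y = g y := by rw [← hv, LinearMap.BilinForm.toDual_def]
  have hA (x y : V) : ω ((f.smulRight v + g.smulRight u) x) y = f x * g y + g x * f y := by
    simp [hu', hv']
  refine ⟨f.smulRight v + g.smulRight u, fun x y => ?_, hA⟩
  rw [hA, ← hAlt.neg_eq, hA]
  ring

/-- Expansion of a quadrilinear form in coordinates. -/
lemma sum_coord_mul_quadrilinear {ι V : Type*} [Fintype ι] [AddCommGroup V] [Module ℝ V]
    (b : Module.Basis ι ℝ V) (R : V →ₗ[ℝ] V →ₗ[ℝ] V →ₗ[ℝ] V →ₗ[ℝ] ℝ) (X Y Z T : V) :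
    ∑ p : ι × ι × ι × ι, R (b p.1) (b p.2.1) (b p.2.2.1) (b p.2.2.2) *
      (b.coord p.1 X * b.coord p.2.1 Y * b.coord p.2.2.1 Z * b.coord p.2.2.2 T) = R X Y Z T := by
  have h (f : V →ₗ[ℝ] ℝ) (x : V) : ∑ i, f (b i) * b.coord i x = f x := by
    conv_rhs => rw [← b.sum_repr x, map_sum]
    simp only [map_smul, smul_eq_mul, Module.Basis.coord_apply, mul_comm]
  simp only [Fintype.sum_prod_type, ← mul_assoc]
  calc _ = ∑ i, (∑ j, (∑ k, (∑ l, R (b i) (b j) (b k) (b l) * b.coord l T) *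
        b.coord k Z) * b.coord j Y) * b.coord i X := by
        simp only [Finset.sum_mul]
        refine Finset.sum_congr rfl fun i _ => Finset.sum_congr rfl fun j _ =>
          Finset.sum_congr rfl fun k _ => Finset.sum_congr rfl fun l _ => ?_
        ring
    _ = R X Y Z T := by
        have hZ (x y : V) : ∑ k, R x y (b k) T * b.coord k Z = R x y Z T := h ((R x y).flip T) Z
        have hY (x : V) : ∑ j, R x (b j) Z T * b.coord j Y = R x Y Z T :=
          h (((R x).flip Z).flip T) Y
        have hX : ∑ i, R (b i) Y Z T * b.coord i X = R X Y Z T :=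
          h (((R.flip Y).flip Z).flip T) X
        simp only [h, hZ, hY, hX]

/-- Every algebraic symplectic curvature tensor `R` on `(V, ω)` is a finite
sum of tensors `φ_{Aᵢ,Bᵢ}` with `Aᵢ, Bᵢ` `ω`-skew (surjectivity of `φ` from `Λ²sp(V,ω)` onto
the space of algebraic symplectic curvature tensors). -/
theorem curvature_tensor_is_sum_of_phiAB
    (V : Type*) [AddCommGroup V] [Module ℝ V] [FiniteDimensional ℝ V]
    (ω : LinearMap.BilinForm ℝ V) (hAlt : ω.IsAlt) (hNd : ω.Nondegenerate)
    (R : V →ₗ[ℝ] V →ₗ[ℝ] V →ₗ[ℝ] V →ₗ[ℝ] ℝ)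
    (hanti : ∀ X Y Z T : V, R Y X Z T = - R X Y Z T)
    (hsym : ∀ X Y Z T : V, R X Y T Z = R X Y Z T)
    (hBianchi : ∀ X Y Z T : V, R X Y Z T + R Y Z X T + R Z X Y T = 0) :
    ∃ (r : ℕ) (A B : Fin r → (V →ₗ[ℝ] V)),
      (∀ i, ∀ x y, ω (A i x) y + ω x (A i y) = 0) ∧
      (∀ i, ∀ x y, ω (B i x) y + ω x (B i y) = 0) ∧
      ∀ X Y Z T : V, R X Y Z T = ∑ i, phiAB ω (A i) (B i) X Y Z T := by
  classical
  let b := Module.finBasis ℝ V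
  let I := Fin (Module.finrank ℝ V)
  let c : I × I × I × I → ℝ := fun p => R (b p.1) (b p.2.1) (b p.2.2.1) (b p.2.2.2)
  choose E hskew hE using exists_skew_eq_symm_mul hAlt hNd
  let e := Fintype.equivFin (I × I × I × I)
  let A : I × I × I × I → (V →ₗ[ℝ] V) := fun p => (c p / 8) • E (b.coord p.1) (b.coord p.2.2.1)
  let B : I × I × I × I → (V →ₗ[ℝ] V) := fun p => E (b.coord p.2.1) (b.coord p.2.2.2)
  refine ⟨_, fun i => A (e.symm i), fun i => B (e.symm i), fun i x y => ?_,
    fun i => hskew _ _, fun X Y Z T => ?_⟩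
  · simp only [A, LinearMap.smul_apply, map_smul, smul_eq_mul, ← mul_add, hskew, mul_zero]
  rw [e.symm.sum_comp (fun p => phiAB ω (A p) (B p) X Y Z T)]
  let S (x y z t : V) : ℝ := ∑ p : I × I × I × I, c p *
    (b.coord p.1 x * b.coord p.2.1 y * b.coord p.2.2.1 z * b.coord p.2.2.2 t)
  have hS (x y z t : V) : S x y z t = R x y z t := sum_coord_mul_quadrilinear b R x y z t
  let F (x y z t : V) : ℝ := S x y t z + S t y x z + S x z t y + S t z x y
  have hF : ∑ p, phiAB ω (A p) (B p) X Y Z T =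
      (1 / 8) * (F X Y Z T - F Y X T Z - F Y X Z T + F X Y T Z) := by
    simp only [F, S, ← Finset.sum_add_distrib, ← Finset.sum_sub_distrib, Finset.mul_sum]
    refine Finset.sum_congr rfl fun p _ => ?_
    simp only [phiAB, A, B, LinearMap.smul_apply, map_smul, smul_eq_mul, hE]
    ring
  rw [hF]
  simp only [F, hS]
  grind
end

section
/- Let (V₁, ω₁) and (V₂, ω₂) be finite-dimensional real symplectic vector spaces. Let C : V₂ → End(V₁) and B : V₂ → End(V₂) be linear maps such that every C(ξ) is ω₁-skew, every B(ξ) is ω₂-skew, and C(ξ)∘C(η) = C(B(ξ)η) for all ξ, η ∈ V₂. Let τ : V₁ × V₁ → V₂ be the bilinear map determined by ω₂(τ(x,y), η) = ω₁(C(η)x, y) for all η ∈ V₂ (it exists and is unique by nondegeneracy of ω₂). For x ∈ V₁ define the endomorphism Λ(x) of V₁ × V₂ by Λ(x)(y,u) := (C(u)x, τ(x,y)). Then for all x₁, x₂, x₃, x₄, x₅ ∈ V₁ one has Λ(x₁)∘Λ(x₂)∘Λ(x₃)∘Λ(x₄)∘Λ(x₅) = 0; in particular each Λ(x) is nilpotent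 with Λ(x)⁵ = 0. -/
/-- With shape data `C`, `B` satisfying `C(ξ)∘C(η) = C(B(ξ)η)` and the
second fundamental form `τ` determined by `ω₂(τ(x,y), η) = ω₁(C(η)x, y)`, the transvection
generators `Λ(x)(y,u) = (C(u)x, τ(x,y))` satisfy `Λ(x₁)∘Λ(x₂)∘Λ(x₃)∘Λ(x₄)∘Λ(x₅) = 0`;
in particular each `Λ(x)` is nilpotent with `Λ(x)⁵ = 0`. -/
theorem transvection_generators_five_products_vanish
    (V₁ V₂ : Type*) [AddCommGroup V₁] [Module ℝ V₁] [FiniteDimensional ℝ V₁]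
    [AddCommGroup V₂] [Module ℝ V₂] [FiniteDimensional ℝ V₂]
    (ω₁ : LinearMap.BilinForm ℝ V₁) (h₁Alt : ω₁.IsAlt) (h₁Nd : ω₁.Nondegenerate)
    (ω₂ : LinearMap.BilinForm ℝ V₂) (h₂Alt : ω₂.IsAlt) (h₂Nd : ω₂.Nondegenerate)
    (C : V₂ →ₗ[ℝ] V₁ →ₗ[ℝ] V₁) (B : V₂ →ₗ[ℝ] V₂ →ₗ[ℝ] V₂)
    (hCskew : ∀ ξ x y, ω₁ (C ξ x) y + ω₁ x (C ξ y) = 0)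
    (hBskew : ∀ ξ x y, ω₂ (B ξ x) y + ω₂ x (B ξ y) = 0)
    (hCC : ∀ ξ η, C ξ ∘ₗ C η = C (B ξ η))
    (τ : V₁ →ₗ[ℝ] V₁ →ₗ[ℝ] V₂)
    (hτ : ∀ x y η, ω₂ (τ x y) η = ω₁ (C η x) y)
    (Λ : V₁ → (V₁ × V₂ →ₗ[ℝ] V₁ × V₂))
    (hΛ : ∀ x y u, Λ x (y, u) = (C u x, τ x y)) :
    (∀ x₁ x₂ x₃ x₄ x₅ : V₁,
        Λ x₁ ∘ₗ Λ x₂ ∘ₗ Λ x₃ ∘ₗ Λ x₄ ∘ₗ Λ x₅ = 0) ∧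
      ∀ x : V₁, Λ x ∘ₗ Λ x ∘ₗ Λ x ∘ₗ Λ x ∘ₗ Λ x = 0 := by
  have inj₁ : ∀ v, (∀ w, ω₁ v w = 0) → v = 0 := h₁Nd.1
  have inj₂ : ∀ v, (∀ w, ω₂ v w = 0) → v = 0 := h₂Nd.1
  have hCC' : ∀ ξ η x, C (B ξ η) x = C ξ (C η x) := fun ξ η x => by
    rw [← hCC, LinearMap.comp_apply]
  -- Taking adjoints in `hCC` shows that the `C ξ` anticommute.
  have anti : ∀ ξ η x, C ξ (C η x) = -C η (C ξ x) := fun ξ η x => by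
    rw [eq_neg_iff_add_eq_zero]
    refine inj₁ _ fun w => ?_
    rw [map_add, LinearMap.add_apply]
    have e₁ := hCskew (B ξ η) x w
    rw [hCC', hCC'] at e₁
    linarith [hCskew η (C ξ x) w, hCskew ξ x (C η w)]
  have triple : ∀ ξ η ζ x, C ξ (C η (C ζ x)) = 0 := fun ξ η ζ x => by
    have e : C ξ (C η (C ζ x)) = -C ξ (C η (C ζ x)) := calc
      C ξ (C η (C ζ x)) = -C ζ (C ξ (C η x)) := by rw [← hCC' ξ η, anti, hCC']
      _ = -C ξ (C η (C ζ x)) := by rw [anti ζ ξ, anti ζ η, map_neg, neg_neg]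
    have : IsAddTorsionFree V₁ := .of_isTorsionFree ℝ V₁
    exact self_eq_neg.mp e
  have hBτ : ∀ ξ x y, τ x (C ξ y) = B ξ (τ x y) := fun ξ x y => by
    rw [← sub_eq_zero]
    refine inj₂ _ fun η => ?_
    have e := hBskew ξ (τ x y) η
    rw [hτ, hCC'] at e
    rw [map_sub, LinearMap.sub_apply, hτ]
    linarith [hCskew ξ (C η x) y]
  have hτCC : ∀ ξ η x y, τ x (C ξ (C η y)) = 0 := fun ξ η x y =>
    inj₂ _ fun ζ => by
      have e := hCskew ζ x (C ξ (C η y))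
      rw [triple, map_zero, add_zero] at e
      rw [hτ, e]
  have main : ∀ x₁ x₂ x₃ x₄ x₅ : V₁,
      Λ x₁ ∘ₗ Λ x₂ ∘ₗ Λ x₃ ∘ₗ Λ x₄ ∘ₗ Λ x₅ = 0 := fun x₁ x₂ x₃ x₄ x₅ => by
    refine LinearMap.ext fun ⟨y, u⟩ => ?_
    simp only [LinearMap.comp_apply, hΛ, LinearMap.zero_apply, Prod.mk_eq_zero]
    constructor
    · rw [hBτ u x₄, hCC', hτCC, map_zero, LinearMap.zero_apply]
    · rw [hBτ _ x₃, hCC', hτCC]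
  exact ⟨main, fun x => main x x x x x⟩
end

section
/- Let (V₁, ω₁) and (V₂, ω₂) be finite-dimensional real symplectic vector spaces. Let C : V₂ → End(V₁) be a linear map such that every C(ξ) is ω₁-skew, and let τ : V₁ × V₁ → V₂ be the bilinear map determined by ω₂(τ(x,y), η) = ω₁(C(η)x, y) for all η ∈ V₂ (it exists and is unique by nondegeneracy of ω₂). Assume the span of the image of τ is ω₂-isotropic, i.e. ω₂(τ(x,y), τ(z,w)) = 0 for all x, y, z, w ∈ V₁. For x ∈ V₁ define the endomorphism Λ(x) of V₁ × V₂ by Λ(x)(y,u) := (C(u)x, τ(x,y)). Then Λ(x)∘Λ(x)∘Λ(x) = 0 for every x ∈ V₁. -/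
/-- With shape data `C` and second fundamental form `τ` determined by
`ω₂(τ(x,y), η) = ω₁(C(η)x, y)`, if the span of the image of `τ` is `ω₂`-isotropic, then the
transvection generators `Λ(x)(y,u) = (C(u)x, τ(x,y))` satisfy `Λ(x)³ = 0`. -/
theorem flat_case_cube_vanishes
    (V₁ V₂ : Type*) [AddCommGroup V₁] [Module ℝ V₁] [FiniteDimensional ℝ V₁]
    [AddCommGroup V₂] [Module ℝ V₂] [FiniteDimensional ℝ V₂]
    (ω₁ : LinearMap.BilinForm ℝ V₁) (h₁Alt : ω₁.IsAlt) (h₁Nd : ω₁.Nondegenerate)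
    (ω₂ : LinearMap.BilinForm ℝ V₂) (h₂Alt : ω₂.IsAlt) (h₂Nd : ω₂.Nondegenerate)
    (C : V₂ →ₗ[ℝ] V₁ →ₗ[ℝ] V₁)
    (hCskew : ∀ ξ x y, ω₁ (C ξ x) y + ω₁ x (C ξ y) = 0)
    (τ : V₁ →ₗ[ℝ] V₁ →ₗ[ℝ] V₂)
    (hτ : ∀ x y η, ω₂ (τ x y) η = ω₁ (C η x) y)
    (hiso : ∀ x y z w : V₁, ω₂ (τ x y) (τ z w) = 0)
    (Λ : V₁ → (V₁ × V₂ →ₗ[ℝ] V₁ × V₂))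
    (hΛ : ∀ x y u, Λ x (y, u) = (C u x, τ x y)) :
    ∀ x : V₁, Λ x ∘ₗ Λ x ∘ₗ Λ x = 0 := by
  have hCτ : ∀ a b z : V₁, C (τ a b) z = 0 := fun a b z =>
    h₁Nd.1 _ fun w => by rw [← hτ, hiso]
  intro x
  refine LinearMap.ext fun ⟨y, u⟩ => ?_
  simp [hΛ, hCτ]
end
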